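/- arXiv:2410.03047 — 4 statements merged into one kernel-verified Lean document; each statement's English description precedes it below -/
import Mathlib

section
/- Let d ≥ 2 and let T be a finite set of complex numbers (a Finset ℂ) with T.card = d − 1. Then the set {a : Fin (d−1) → ℂ | cvl(p_a) = T.val} of monic centered degree-d polynomials whose critical value multiset consists of the d−1 distinct elements of T, each with multiplicity one, is finite and has exactly d^{d−2} elements. (The Lyashko–Looijenga map from monic centered degree-d polynomials to their critical value multisets is a finite map of degree d^{d−2}.) -/
open Polynomial

/-- The monic centered polynomial `X^d + ∑_{i=0}^{d-2} (a i)·X^i` determined by the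
coefficient vector `a`. -/
noncomputable def mcPoly (d : ℕ) (a : Fin (d - 1) → ℂ) : ℂ[X] :=
  X ^ d + ∑ i : Fin (d - 1), C (a i) * X ^ (i : ℕ)

/-- The critical value multiset of a polynomial: the multiset of values of `p` at the
roots (with multiplicity) of its derivative. -/
noncomputable def cvl (p : ℂ[X]) : Multiset ℂ :=
  Multiset.map (fun z => p.eval z) p.derivative.roots

theorem finrank_restrictTotalDegree {σ : Type*} [Fintype σ] (k : ℕ) :
    Module.finrank ℂ (MvPolynomial.restrictTotalDegree σ ℂ k) =
      (k + Fintype.card σ).choose (Fintype.card σ) := by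
  classical
  change Module.finrank ℂ (MvPolynomial.restrictSupport ℂ
    {n : σ →₀ ℕ | (n.sum fun _ e => e) ≤ k}) = _
  rw [Module.finrank_eq_nat_card_basis (MvPolynomial.basisRestrictSupport ℂ
    {n : σ →₀ ℕ | (n.sum fun _ e => e) ≤ k})]
  have hset : {n : σ →₀ ℕ | (n.sum fun _ e => e) ≤ k} =
      ((Finset.range (k + 1)).biUnion fun n => Finset.finsuppAntidiag Finset.univ n :
        Finset (σ →₀ ℕ)) := by
    ext n
    simp [Finsupp.sum_fintype]
  rw [hset, Nat.card_coe_set_eq, Set.ncard_coe_finset, Finset.card_biUnion]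
  · simp only [Finset.card_finsuppAntidiag_nat_eq_multichoose, Finset.card_univ]
    rw [show (k + Fintype.card σ).choose (Fintype.card σ) =
      (Fintype.card σ + 1).multichoose k by
        rw [Nat.multichoose_eq, Nat.add_right_comm, Nat.add_sub_cancel, add_comm k,
          ← Nat.choose_symm_add]]
    clear hset
    generalize Fintype.card σ = m
    induction k with
    | zero => simp
    | succ k ih =>
      rw [Finset.sum_range_succ, ih, Nat.multichoose_succ_succ, add_comm]
  · intro a _ b _ hab
    rw [Function.onFun, Finset.disjoint_left]
    intro n ha hb
    rw [Finset.mem_finsuppAntidiag] at ha hb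
    exact hab (ha.1.symm.trans hb.1)

theorem mul_pow_le_mul_pow_of_forall_choose_le {m a b p q r : ℕ}
    (h : ∀ k, a * (p * k + m).choose m ≤ b * (q * k + r + m).choose m) :
    a * p ^ m ≤ b * q ^ m := by
  have key : ∀ k : ℕ, a * (p * k) ^ m ≤ b * (q * k + (r + m)) ^ m := by
    intro k
    have h1 : (p * k) ^ m ≤ m.factorial * (p * k + m).choose m := by
      rw [← Nat.ascFactorial_eq_factorial_mul_choose]
      exact (Nat.pow_le_pow_left (Nat.le_succ _) m).trans (Nat.pow_succ_le_ascFactorial _ _)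
    have h2 : m.factorial * (q * k + r + m).choose m ≤ (q * k + (r + m)) ^ m := by
      rw [← Nat.ascFactorial_eq_factorial_mul_choose, ← add_assoc]
      exact Nat.ascFactorial_le_pow_add _ _
    calc a * (p * k) ^ m ≤ a * (m.factorial * (p * k + m).choose m) := by gcongr
      _ = m.factorial * (a * (p * k + m).choose m) := by ring
      _ ≤ m.factorial * (b * (q * k + r + m).choose m) :=
        Nat.mul_le_mul_left _ (h k)
      _ = b * (m.factorial * (q * k + r + m).choose m) := by ring
      _ ≤ _ := by gcongr
  have hlim : Filter.Tendsto (fun k : ℕ => (b : ℝ) * (q + ((r + m : ℕ) : ℝ) / k) ^ m) Filter.atTop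
      (nhds (b * (q + 0) ^ m)) :=
    ((tendsto_const_div_atTop_nhds_zero_nat _).const_add _ |>.pow m).const_mul _
  have : ((a : ℝ) * p ^ m) ≤ b * (q + 0) ^ m := by
    refine ge_of_tendsto hlim ?_
    filter_upwards [Filter.eventually_gt_atTop 0] with k hk
    have hk' : (0 : ℝ) < k := by exact_mod_cast hk
    have := key k
    have h3 : (a : ℝ) * (p * k) ^ m ≤ b * (q * k + (r + m : ℕ)) ^ m := by exact_mod_cast this
    have h4 : (q : ℝ) * k + (r + m : ℕ) = (q + (r + m : ℕ) / k) * k := by field_simp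
    rw [h4, mul_pow, mul_pow, ← mul_assoc, ← mul_assoc] at h3
    exact le_of_mul_le_mul_right h3 (by positivity)
  rw [add_zero] at this
  exact_mod_cast this

theorem homogeneousComponent_mul_of_isHomogeneous {σ : Type*} {d : ℕ}
    {g : MvPolynomial σ ℂ} (hg : g.IsHomogeneous d) (a : MvPolynomial σ ℂ) (k : ℕ) :
    MvPolynomial.homogeneousComponent (k + d) (a * g) =
      MvPolynomial.homogeneousComponent k a * g := by
  conv_lhs => rw [← MvPolynomial.sum_homogeneousComponent a]
  rw [Finset.sum_mul, map_sum]
  have h : ∀ i, MvPolynomial.homogeneousComponent (k + d)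
      (MvPolynomial.homogeneousComponent i a * g) =
      if k = i then MvPolynomial.homogeneousComponent i a * g else 0 := by
    intro i
    rw [MvPolynomial.homogeneousComponent_of_mem
      ((MvPolynomial.homogeneousComponent_isHomogeneous i a).mul hg)]
    simp
  simp only [h, Finset.sum_ite_eq, Finset.mem_range]
  split_ifs with hk
  · rfl
  · rw [MvPolynomial.homogeneousComponent_eq_zero _ _ (by omega), zero_mul]

/-- Sums `∑ β, c_β(G) X^β` over `β ∈ S` with coefficients `c_β` of total degree at most `n`. -/
noncomputable def boundedCombinations {ι σ : Type*} (G : ι → MvPolynomial σ ℂ)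
    (S : Finset (σ →₀ ℕ)) (n : ℕ) : Submodule ℂ (MvPolynomial σ ℂ) where
  carrier := {f | ∃ c : (σ →₀ ℕ) → MvPolynomial ι ℂ,
    (∀ β, c β ∈ MvPolynomial.restrictTotalDegree ι ℂ n) ∧
      f = ∑ β ∈ S, MvPolynomial.aeval G (c β) * MvPolynomial.monomial β 1}
  zero_mem' := ⟨0, fun _ => Submodule.zero_mem _, by simp⟩
  add_mem' := by
    rintro _ _ ⟨c, hc, rfl⟩ ⟨c', hc', rfl⟩
    exact ⟨c + c', fun β => Submodule.add_mem _ (hc β) (hc' β), by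
      simp [add_mul, Finset.sum_add_distrib]⟩
  smul_mem' := by
    rintro r _ ⟨c, hc, rfl⟩
    exact ⟨r • c, fun β => Submodule.smul_mem _ _ (hc β), by
      simp [Finset.smul_sum]⟩

theorem boundedCombinations_mono {ι σ : Type*} {G : ι → MvPolynomial σ ℂ}
    {S : Finset (σ →₀ ℕ)} {n n' : ℕ} (h : n ≤ n') :
    boundedCombinations G S n ≤ boundedCombinations G S n' := by
  rintro _ ⟨c, hc, rfl⟩
  refine ⟨c, fun β => ?_, rfl⟩
  rw [MvPolynomial.mem_restrictTotalDegree]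
  exact ((MvPolynomial.mem_restrictTotalDegree _ _ _).1 (hc β)).trans h

theorem mul_mem_boundedCombinations {ι σ : Type*} {G : ι → MvPolynomial σ ℂ}
    {S : Finset (σ →₀ ℕ)} {n : ℕ} {f : MvPolynomial σ ℂ} (hf : f ∈ boundedCombinations G S n)
    (i : ι) : f * G i ∈ boundedCombinations G S (n + 1) := by
  obtain ⟨c, hc, rfl⟩ := hf
  refine ⟨fun β => c β * MvPolynomial.X i, fun β => ?_, ?_⟩
  · rw [MvPolynomial.mem_restrictTotalDegree]
    refine (MvPolynomial.totalDegree_mul _ _).trans (add_le_add ?_ (by simp))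
    exact (MvPolynomial.mem_restrictTotalDegree _ _ _).1 (hc β)
  · rw [Finset.sum_mul]
    refine Finset.sum_congr rfl fun β _ => ?_
    simp
    ring

theorem exists_monomial_mem_span_range {ι σ : Type*} [Fintype ι] [Fintype σ]
    {G : ι → MvPolynomial σ ℂ} (h0 : ∀ x : σ → ℂ, (∀ i, MvPolynomial.eval x (G i) = 0) → x = 0) :
    ∃ D : ℕ, ∀ β : σ →₀ ℕ, D ≤ β.degree →
      MvPolynomial.monomial β 1 ∈ Ideal.span (Set.range G) := by
  classical
  have hX : ∀ j : σ, ∃ K : ℕ, (MvPolynomial.X j) ^ K ∈ Ideal.span (Set.range G) := by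
    intro j
    change MvPolynomial.X j ∈ (Ideal.span (Set.range G)).radical
    rw [← MvPolynomial.vanishingIdeal_zeroLocus_eq_radical (K := ℂ)]
    intro x hx
    have : x = 0 := h0 x fun i => by
      have := hx (G i) (Ideal.subset_span ⟨i, rfl⟩)
      simpa [MvPolynomial.aeval_eq_eval] using this
    simp [this]
  choose K hK using hX
  refine ⟨∑ j, K j + 1, fun β hβ => ?_⟩
  have : ∃ j, K j ≤ β j := by
    by_contra! hcon
    have h2 : β.degree ≤ ∑ j, K j := by
      rw [Finsupp.degree_eq_sum]
      exact Finset.sum_le_sum fun j _ => (hcon j).le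
    omega
  obtain ⟨j, hj⟩ := this
  have h3 : (MvPolynomial.monomial β 1 : MvPolynomial σ ℂ) =
      MvPolynomial.monomial (β - Finsupp.single j (K j)) 1 * MvPolynomial.X j ^ K j := by
    rw [MvPolynomial.X_pow_eq_monomial, MvPolynomial.monomial_mul, one_mul,
      tsub_add_cancel_of_le (by simpa using hj)]
  rw [h3]
  exact Ideal.mul_mem_left _ _ (hK j)

theorem exists_forall_mem_boundedCombinations {ι σ : Type*} [Fintype ι] [Fintype σ] {d : ℕ}
    (hd : 0 < d) {G : ι → MvPolynomial σ ℂ} (hG : ∀ i, (G i).IsHomogeneous d)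
    (h0 : ∀ x : σ → ℂ, (∀ i, MvPolynomial.eval x (G i) = 0) → x = 0) :
    ∃ S : Finset (σ →₀ ℕ), ∀ f : MvPolynomial σ ℂ,
      f ∈ boundedCombinations G S (f.totalDegree / d) := by
  classical
  obtain ⟨D, hD⟩ := exists_monomial_mem_span_range h0
  let S : Finset (σ →₀ ℕ) := (Finsupp.finite_of_degree_le (σ := σ) (D + d)).toFinset
  have hS : ∀ β, β ∈ S ↔ β.degree ≤ D + d := fun β => by simp [S]
  have hom : ∀ (k : ℕ) (f : MvPolynomial σ ℂ), f.IsHomogeneous k →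
      f ∈ boundedCombinations G S (k / d) := by
    intro k
    induction k using Nat.strong_induction_on with
    | _ k ih =>
      intro f hf
      rcases le_or_gt k (D + d) with hk | hk
      · refine boundedCombinations_mono (Nat.zero_le _) ⟨fun β => MvPolynomial.C (f.coeff β),
          fun β => ?_, ?_⟩
        · simp [MvPolynomial.mem_restrictTotalDegree]
        · have hsub : f.support ⊆ S := fun β hβ => by
            rw [hS, Finsupp.degree_eq_weight_one]
            exact (hf (MvPolynomial.mem_support_iff.1 hβ)).trans_le hk
          conv_lhs => rw [f.as_sum]
          rw [Finset.sum_subset hsub]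
          · refine Finset.sum_congr rfl fun β _ => ?_
            simp [MvPolynomial.C_mul_monomial]
          · intro β _ hβ
            simp [MvPolynomial.notMem_support_iff.1 hβ]
      · have hmem : f ∈ Ideal.span (Set.range G) := by
          rw [f.as_sum]
          refine Ideal.sum_mem _ fun β hβ => ?_
          have h1 : D ≤ β.degree := by
            have := hf (MvPolynomial.mem_support_iff.1 hβ)
            rw [Finsupp.degree_eq_weight_one]
            exact (by omega : D ≤ k).trans_eq this.symm
          rw [← mul_one (f.coeff β), ← MvPolynomial.C_mul_monomial]
          exact Ideal.mul_mem_left _ _ (hD β h1)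
        obtain ⟨a, ha⟩ := Ideal.mem_span_range_iff_exists_fun.1 hmem
        obtain ⟨l, rfl⟩ : ∃ l, k = l + d := ⟨k - d, by omega⟩
        rw [← MvPolynomial.homogeneousComponent_eq_self hf, ← ha, map_sum]
        refine Submodule.sum_mem _ fun i _ => ?_
        rw [homogeneousComponent_mul_of_isHomogeneous (hG i), Nat.add_div_right _ hd]
        exact mul_mem_boundedCombinations
          (ih l (by omega) _ (MvPolynomial.homogeneousComponent_isHomogeneous _ _)) i
  refine ⟨S, fun f => ?_⟩
  rw [← MvPolynomial.sum_homogeneousComponent f]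
  conv in (MvPolynomial.totalDegree _ / d) => rw [MvPolynomial.sum_homogeneousComponent f]
  refine Submodule.sum_mem _ fun i hi => ?_
  refine boundedCombinations_mono (Nat.div_le_div_right ?_)
    (hom i _ (MvPolynomial.homogeneousComponent_isHomogeneous _ _))
  exact Nat.lt_succ_iff.1 (Finset.mem_range.1 hi)

theorem finite_aeval_of_isHomogeneous {ι σ : Type*} [Fintype ι] [Fintype σ] {d : ℕ}
    (hd : 0 < d) {G : ι → MvPolynomial σ ℂ} (hG : ∀ i, (G i).IsHomogeneous d)
    (h0 : ∀ x : σ → ℂ, (∀ i, MvPolynomial.eval x (G i) = 0) → x = 0) :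
    (MvPolynomial.aeval G : MvPolynomial ι ℂ →ₐ[ℂ] MvPolynomial σ ℂ).toRingHom.Finite := by
  classical
  obtain ⟨S, hS⟩ := exists_forall_mem_boundedCombinations hd hG h0
  let _ := (MvPolynomial.aeval G : MvPolynomial ι ℂ →ₐ[ℂ] MvPolynomial σ ℂ).toRingHom.toAlgebra
  refine ⟨⟨S.image fun β => MvPolynomial.monomial β 1, ?_⟩⟩
  rw [eq_top_iff]
  rintro f -
  obtain ⟨c, -, hc⟩ := hS f
  rw [hc]
  refine Submodule.sum_mem _ fun β hβ => ?_
  exact Submodule.smul_mem _ (c β) (Submodule.subset_span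
    (Finset.mem_coe.2 (Finset.mem_image_of_mem _ hβ)))

theorem aeval_injective_of_isHomogeneous {ι σ : Type*} [Fintype ι] [Fintype σ] {d : ℕ}
    (hd : 0 < d) {G : ι → MvPolynomial σ ℂ} (hG : ∀ i, (G i).IsHomogeneous d)
    (h0 : ∀ x : σ → ℂ, (∀ i, MvPolynomial.eval x (G i) = 0) → x = 0)
    (hcard : Fintype.card ι = Fintype.card σ) :
    Function.Injective (MvPolynomial.aeval G : MvPolynomial ι ℂ →ₐ[ℂ] MvPolynomial σ ℂ) := by
  have hfin := (finite_aeval_of_isHomogeneous hd hG h0).to_isIntegral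
  have : Algebra.IsAlgebraic (Algebra.adjoin ℂ (Set.range G)) (MvPolynomial σ ℂ) := by
    rw [Algebra.adjoin_range_eq_range_aeval]
    refine ⟨fun a => IsIntegral.isAlgebraic ?_⟩
    have h := hfin a
    exact RingHom.IsIntegralElem.of_comp
      (f := (MvPolynomial.aeval G : MvPolynomial ι ℂ →ₐ[ℂ] MvPolynomial σ ℂ
        ).rangeRestrict.toRingHom)
      (g := algebraMap (MvPolynomial.aeval G : MvPolynomial ι ℂ →ₐ[ℂ] MvPolynomial σ ℂ).range
        (MvPolynomial σ ℂ)) h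
  have h := Algebra.IsAlgebraic.isTranscendenceBasis_of_lift_le_trdeg_of_finite ℂ G (by
    simp [MvPolynomial.trdeg_of_isDomain, hcard])
  exact h.1

theorem totalDegree_aeval_le {ι σ : Type*} {d : ℕ} {G : ι → MvPolynomial σ ℂ}
    (hG : ∀ i, (G i).totalDegree ≤ d) (p : MvPolynomial ι ℂ) :
    (MvPolynomial.aeval G p).totalDegree ≤ d * p.totalDegree := by
  rw [MvPolynomial.aeval_def, MvPolynomial.eval₂_eq]
  refine MvPolynomial.totalDegree_finsetSum_le fun n hn => ?_
  refine (MvPolynomial.totalDegree_mul _ _).trans ?_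
  rw [MvPolynomial.algebraMap_eq, MvPolynomial.totalDegree_C, zero_add]
  refine (MvPolynomial.totalDegree_finsetProd _ _).trans ?_
  calc ∑ i ∈ n.support, (G i ^ n i).totalDegree ≤ ∑ i ∈ n.support, d * n i := by
        refine Finset.sum_le_sum fun i _ => (MvPolynomial.totalDegree_pow _ _).trans ?_
        rw [mul_comm]
        exact Nat.mul_le_mul_right _ (hG i)
    _ = d * n.sum fun _ e => e := by rw [← Finset.mul_sum]; rfl
    _ ≤ d * p.totalDegree := Nat.mul_le_mul_left _ (MvPolynomial.le_totalDegree hn)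

theorem exists_totalDegree_le_one_injOn_eval {σ : Type*} [Fintype σ] (F : Finset (σ → ℂ)) :
    ∃ θ : MvPolynomial σ ℂ, θ.totalDegree ≤ 1 ∧
      Set.InjOn (fun x => MvPolynomial.eval x θ) (F : Set (σ → ℂ)) := by
  classical
  obtain ⟨f, hf⟩ := Module.exists_dual_forall_apply_ne_zero (K := ℂ)
    (fun p : {p : F × F // p.1 ≠ p.2} => (p.1.1 : σ → ℂ) - p.1.2)
    (fun p => sub_ne_zero.2 fun h => p.2 (Subtype.ext h))
  refine ⟨∑ j, MvPolynomial.C (f (Pi.single j 1)) * MvPolynomial.X j, ?_, ?_⟩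
  · refine MvPolynomial.totalDegree_finsetSum_le fun j _ => ?_
    exact (MvPolynomial.totalDegree_mul _ _).trans (by simp)
  · have hev : ∀ x, MvPolynomial.eval x
        (∑ j, MvPolynomial.C (f (Pi.single j 1)) * MvPolynomial.X j) = f x := by
      intro x
      conv_rhs => rw [pi_eq_sum_univ' x, map_sum]
      simp only [map_sum, map_mul, MvPolynomial.eval_C, MvPolynomial.eval_X, map_smul,
        smul_eq_mul]
      refine Finset.sum_congr rfl fun j _ => ?_
      rw [mul_comm]
    intro x hx x' hx' h
    by_contra hne
    refine hf ⟨(⟨x, hx⟩, ⟨x', hx'⟩), fun h => hne (congrArg Subtype.val h)⟩ ?_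
    simp only [hev] at h
    simp [h]

theorem natDegree_ge_card_of_aeval_eq_zero {ι σ : Type*} [Finite ι]
    {G : ι → MvPolynomial σ ℂ}
    (hfin : (MvPolynomial.aeval G : MvPolynomial ι ℂ →ₐ[ℂ] MvPolynomial σ ℂ).toRingHom.Finite)
    (hinj : Function.Injective
      (MvPolynomial.aeval G : MvPolynomial ι ℂ →ₐ[ℂ] MvPolynomial σ ℂ))
    {y : ι → ℂ} {F : Finset (σ → ℂ)} (hF : ∀ x ∈ F, ∀ i, MvPolynomial.eval x (G i) = y i)
    {θ : MvPolynomial σ ℂ} (hθ : Set.InjOn (fun x => MvPolynomial.eval x θ) (F : Set (σ → ℂ)))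
    {Q : (MvPolynomial ι ℂ)[X]} (hQ : Q ≠ 0)
    (hQθ : Q.eval₂ (MvPolynomial.aeval G : MvPolynomial ι ℂ →ₐ[ℂ] MvPolynomial σ ℂ).toRingHom θ
      = 0) :
    F.card ≤ Q.natDegree := by
  classical
  let φ := (MvPolynomial.aeval G : MvPolynomial ι ℂ →ₐ[ℂ] MvPolynomial σ ℂ).toRingHom
  let _ : Algebra (MvPolynomial ι ℂ) (MvPolynomial σ ℂ) := φ.toAlgebra
  have hfaith : FaithfulSMul (MvPolynomial ι ℂ) (MvPolynomial σ ℂ) :=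
    (faithfulSMul_iff_algebraMap_injective _ _).2 hinj
  have hθ_integral : IsIntegral (MvPolynomial ι ℂ) θ := hfin.to_isIntegral θ
  have hdvd := minpoly.isIntegrallyClosed_dvd hθ_integral (p := Q) hQθ
  refine le_trans ?_ (Polynomial.natDegree_le_of_dvd hdvd hQ)
  set μ := (minpoly (MvPolynomial ι ℂ) θ).map (MvPolynomial.eval y) with hμ
  have hmonic : μ.Monic := (minpoly.monic hθ_integral).map _
  rw [← (minpoly.monic hθ_integral).natDegree_map (MvPolynomial.eval y), ← hμ,
    ← Finset.card_image_of_injOn hθ]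
  refine (Finset.card_le_card (t := μ.roots.toFinset) ?_).trans
    ((Multiset.toFinset_card_le _).trans (Polynomial.card_roots' _))
  intro z hz
  obtain ⟨x, hx, rfl⟩ := Finset.mem_image.1 hz
  have hcomp : MvPolynomial.eval y = (MvPolynomial.eval x).comp φ := by
    refine MvPolynomial.ringHom_ext (fun r => ?_) fun i => ?_
    · simp [φ]
    · simp [φ, hF x hx]
  rw [Multiset.mem_toFinset, Polynomial.mem_roots hmonic.ne_zero, Polynomial.IsRoot.def, hμ,
    Polynomial.eval_map, hcomp, ← Polynomial.hom_eval₂]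
  exact (congrArg _ (minpoly.aeval (MvPolynomial ι ℂ) θ)).trans (map_zero _)

theorem card_le_pow_of_forall_eval_eq {ι σ : Type*} [Fintype ι] [Fintype σ] {d : ℕ}
    (hd : 0 < d) {G : ι → MvPolynomial σ ℂ} (hG : ∀ i, (G i).IsHomogeneous d)
    (h0 : ∀ x : σ → ℂ, (∀ i, MvPolynomial.eval x (G i) = 0) → x = 0)
    (hcard : Fintype.card ι = Fintype.card σ) {y : ι → ℂ} {F : Finset (σ → ℂ)}
    (hF : ∀ x ∈ F, ∀ i, MvPolynomial.eval x (G i) = y i) :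
    F.card ≤ d ^ Fintype.card σ := by
  classical
  obtain ⟨θ, hθ1, hθ⟩ := exists_totalDegree_le_one_injOn_eval F
  have hfin := finite_aeval_of_isHomogeneous hd hG h0
  have hinj := aeval_injective_of_isHomogeneous hd hG h0 hcard
  suffices h : F.card * 1 ^ Fintype.card σ ≤ 1 * d ^ Fintype.card σ by simpa using h
  refine mul_pow_le_mul_pow_of_forall_choose_le (r := F.card) fun k => ?_
  let L : (Fin F.card → MvPolynomial.restrictTotalDegree ι ℂ k) →ₗ[ℂ]
      MvPolynomial.restrictTotalDegree σ ℂ (d * k + F.card) :=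
    LinearMap.codRestrict _
      (∑ i : Fin F.card, (LinearMap.mulRight ℂ (θ ^ (i : ℕ))) ∘ₗ
        (MvPolynomial.aeval G : MvPolynomial ι ℂ →ₐ[ℂ] MvPolynomial σ ℂ).toLinearMap ∘ₗ
        (Submodule.subtype _) ∘ₗ LinearMap.proj i) (by
      intro q
      rw [LinearMap.sum_apply]
      refine Submodule.sum_mem _ fun i _ => ?_
      rw [MvPolynomial.mem_restrictTotalDegree]
      refine (MvPolynomial.totalDegree_mul _ _).trans (add_le_add ?_ ?_)
      · refine (totalDegree_aeval_le (fun i => (hG i).totalDegree_le) _).trans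
          (Nat.mul_le_mul_left _ ?_)
        exact (MvPolynomial.mem_restrictTotalDegree _ _ _).1 (q i).2
      · refine (MvPolynomial.totalDegree_pow _ _).trans ?_
        nlinarith [i.2])
  have hL : Function.Injective L := by
    rw [← LinearMap.ker_eq_bot, LinearMap.ker_eq_bot']
    intro q hq
    by_contra hne
    let Q : (MvPolynomial ι ℂ)[X] := ∑ i : Fin F.card, C (q i : MvPolynomial ι ℂ) * X ^ (i : ℕ)
    have hcoeff : ∀ i : Fin F.card, Q.coeff i = q i := by
      intro i
      simp [Q, Polynomial.finsetSum_coeff, Polynomial.coeff_C_mul, Polynomial.coeff_X_pow,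
        Fin.val_inj]
    have hQ : Q ≠ 0 := by
      intro hQ
      refine hne (funext fun i => Subtype.ext ?_)
      rw [← hcoeff, hQ]
      simp
    have hdeg : Q.degree < F.card := Polynomial.degree_sum_fin_lt _
    have hev : Q.eval₂
        (MvPolynomial.aeval G : MvPolynomial ι ℂ →ₐ[ℂ] MvPolynomial σ ℂ).toRingHom θ = 0 := by
      have := congrArg Subtype.val hq
      simpa [L, Q, Polynomial.eval₂_finsetSum] using this
    have h1 := natDegree_ge_card_of_aeval_eq_zero hfin hinj hF hθ hQ hev
    rw [Polynomial.degree_eq_natDegree hQ, Nat.cast_lt] at hdeg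
    omega
  have h := LinearMap.finrank_le_finrank_of_injective hL
  rw [Module.finrank_pi_fintype] at h
  simpa [finrank_restrictTotalDegree, hcard] using h

theorem exists_eval_eq_ite {σ : Type*} [Fintype σ] [DecidableEq (σ → ℂ)] (F : Finset (σ → ℂ)) :
    ∃ e : (σ → ℂ) → MvPolynomial σ ℂ, ∀ x ∈ F, ∀ x' ∈ F,
      MvPolynomial.eval x' (e x) = if x' = x then 1 else 0 := by
  obtain ⟨θ, -, hθ⟩ := exists_totalDegree_le_one_injOn_eval F
  refine ⟨fun x => Polynomial.aeval θ (Lagrange.basis F (fun x => MvPolynomial.eval x θ) x),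
    fun x hx x' hx' => ?_⟩
  have h : ∀ p : ℂ[X], MvPolynomial.eval x' (Polynomial.aeval θ p) =
      p.eval (MvPolynomial.eval x' θ) := by
    intro p
    rw [← MvPolynomial.coe_aeval_eq_eval, RingHom.coe_coe, ← Polynomial.aeval_algHom_apply,
      Polynomial.coe_aeval_eq_eval]
  rw [h]
  split_ifs with hxx
  · rw [hxx]
    exact Lagrange.eval_basis_self (F := ℂ) (v := fun x => MvPolynomial.eval x θ) hθ hx
  · exact Lagrange.eval_basis_of_ne (F := ℂ) (v := fun x => MvPolynomial.eval x θ) (Ne.symm hxx) hx'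

theorem exists_aeval_mul_mem_span {ι σ : Type*} [Fintype ι] [Fintype σ]
    {G : ι → MvPolynomial σ ℂ}
    (hfin : (MvPolynomial.aeval G : MvPolynomial ι ℂ →ₐ[ℂ] MvPolynomial σ ℂ).toRingHom.Finite)
    {y : ι → ℂ} {F : Finset (σ → ℂ)}
    (hF : ∀ x, (∀ i, MvPolynomial.eval x (G i) = y i) → x ∈ F)
    (hrad : (Ideal.span (Set.range fun i => G i - MvPolynomial.C (y i))).IsRadical)
    {e : (σ → ℂ) → MvPolynomial σ ℂ} [DecidableEq (σ → ℂ)]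
    (he : ∀ x ∈ F, ∀ x' ∈ F, MvPolynomial.eval x' (e x) = if x' = x then 1 else 0) :
    ∃ b : MvPolynomial ι ℂ, b ≠ 0 ∧ ∀ f : MvPolynomial σ ℂ,
      ∃ c : F → MvPolynomial ι ℂ,
        MvPolynomial.aeval G b * f = ∑ x : F, MvPolynomial.aeval G (c x) * e x := by
  let _ := (MvPolynomial.aeval G : MvPolynomial ι ℂ →ₐ[ℂ] MvPolynomial σ ℂ).toRingHom.toAlgebra
  have hsmul : ∀ (p : MvPolynomial ι ℂ) (f : MvPolynomial σ ℂ),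
    p • f = MvPolynomial.aeval G p * f := fun _ _ => rfl
  have hFG : (⊤ : Submodule (MvPolynomial ι ℂ) (MvPolynomial σ ℂ)).FG := hfin.1
  let N : Submodule (MvPolynomial ι ℂ) (MvPolynomial σ ℂ) := Submodule.span _ (e '' F)
  have hle : (⊤ : Submodule (MvPolynomial ι ℂ) (MvPolynomial σ ℂ)) ≤
      N ⊔ RingHom.ker (MvPolynomial.eval y) • ⊤ := by
    rintro f -
    have h1 : ∑ x ∈ F, MvPolynomial.C (MvPolynomial.eval x f) * e x ∈ N := by
      refine Submodule.sum_mem _ fun x hx => ?_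
      have : MvPolynomial.C (MvPolynomial.eval x f) * e x =
          (MvPolynomial.C (MvPolynomial.eval x f) : MvPolynomial ι ℂ) • e x := by
        simp [hsmul]
      rw [this]
      exact Submodule.smul_mem _ _ (Submodule.subset_span ⟨x, hx, rfl⟩)
    have h2 : f - ∑ x ∈ F, MvPolynomial.C (MvPolynomial.eval x f) * e x ∈
        Ideal.span (Set.range fun i => G i - MvPolynomial.C (y i)) := by
      rw [← hrad.radical, ← MvPolynomial.vanishingIdeal_zeroLocus_eq_radical (K := ℂ)]
      intro x hx
      have hxF : x ∈ F := hF x fun i => by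
        have := hx _ (Ideal.subset_span ⟨i, rfl⟩)
        simpa [MvPolynomial.aeval_eq_eval, sub_eq_zero] using this
      rw [MvPolynomial.aeval_eq_eval, map_sub, map_sum]
      rw [Finset.sum_congr rfl (g := fun x' => if x = x' then MvPolynomial.eval x' f else 0)]
      · simp [hxF]
      · intro x' hx'
        simp [he x' hx' x hxF]
    obtain ⟨a, ha⟩ := Ideal.mem_span_range_iff_exists_fun.1 h2
    have h3 : f - ∑ x ∈ F, MvPolynomial.C (MvPolynomial.eval x f) * e x ∈
        RingHom.ker (MvPolynomial.eval y) •
          (⊤ : Submodule (MvPolynomial ι ℂ) (MvPolynomial σ ℂ)) := by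
      rw [← ha]
      refine Submodule.sum_mem _ fun i _ => ?_
      have : a i * (G i - MvPolynomial.C (y i)) =
          (MvPolynomial.X i - MvPolynomial.C (y i) : MvPolynomial ι ℂ) • a i := by
        simp [hsmul, mul_comm]
      rw [this]
      exact Submodule.smul_mem_smul (by simp [RingHom.mem_ker]) trivial
    rw [← add_sub_cancel (∑ x ∈ F, MvPolynomial.C (MvPolynomial.eval x f) * e x) f]
    exact Submodule.add_mem_sup h1 h3
  obtain ⟨b, hb, hbN⟩ := Submodule.exists_sub_one_mem_and_smul_le_of_fg_of_le_sup hFG le_rfl hle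
  refine ⟨b, ?_, fun f => ?_⟩
  · rintro rfl
    simp [RingHom.mem_ker] at hb
  · have h4 : MvPolynomial.aeval G b * f ∈ N :=
      hbN (Submodule.smul_mem_pointwise_smul f b ⊤ trivial)
    obtain ⟨c, hc⟩ := (Submodule.mem_span_image_finset_iff_exists_fun _).1 h4
    exact ⟨c, hc.symm⟩

theorem pow_le_card_of_isRadical {ι σ : Type*} [Fintype ι] [Fintype σ] {d : ℕ}
    (hd : 0 < d) {G : ι → MvPolynomial σ ℂ} (hG : ∀ i, (G i).IsHomogeneous d)
    (h0 : ∀ x : σ → ℂ, (∀ i, MvPolynomial.eval x (G i) = 0) → x = 0)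
    (hcard : Fintype.card ι = Fintype.card σ) {y : ι → ℂ} {F : Finset (σ → ℂ)}
    (hF : ∀ x, (∀ i, MvPolynomial.eval x (G i) = y i) → x ∈ F)
    (hrad : (Ideal.span (Set.range fun i => G i - MvPolynomial.C (y i))).IsRadical) :
    d ^ Fintype.card σ ≤ F.card := by
  classical
  obtain ⟨S, hS⟩ := exists_forall_mem_boundedCombinations hd hG h0
  have hinj := aeval_injective_of_isHomogeneous hd hG h0 hcard
  obtain ⟨e, he⟩ := exists_eval_eq_ite F
  obtain ⟨b, hb0, hb⟩ :=
    exists_aeval_mul_mem_span (finite_aeval_of_isHomogeneous hd hG h0) hF hrad he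
  choose c hc using fun β : σ →₀ ℕ => hb (MvPolynomial.monomial β 1)
  let r := ∑ β ∈ S, ∑ x, (c β x).totalDegree
  suffices h : 1 * d ^ Fintype.card σ ≤ F.card * 1 ^ Fintype.card σ by simpa using h
  refine mul_pow_le_mul_pow_of_forall_choose_le (r := r) fun k => ?_
  let L : (F → MvPolynomial.restrictTotalDegree ι ℂ (k + r)) →ₗ[ℂ] MvPolynomial σ ℂ :=
    ∑ x : F, (LinearMap.mulRight ℂ (e x)) ∘ₗ
        (MvPolynomial.aeval G : MvPolynomial ι ℂ →ₐ[ℂ] MvPolynomial σ ℂ).toLinearMap ∘ₗ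
        (Submodule.subtype _) ∘ₗ LinearMap.proj x
  have hLapp : ∀ q, L q = ∑ x : F, MvPolynomial.aeval G (q x : MvPolynomial ι ℂ) * e x := by
    intro q
    simp [L]
  let B : MvPolynomial.restrictTotalDegree σ ℂ (d * k) →ₗ[ℂ] LinearMap.range L :=
    LinearMap.codRestrict _ ((LinearMap.mulLeft ℂ (MvPolynomial.aeval G b)) ∘ₗ
      (Submodule.subtype _)) (by
      rintro ⟨f, hf⟩
      rw [MvPolynomial.mem_restrictTotalDegree] at hf
      obtain ⟨p, hp, hpf⟩ := boundedCombinations_mono (n' := k)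
        (Nat.div_le_of_le_mul hf) (hS f)
      refine ⟨fun x => ⟨∑ β ∈ S, p β * c β x, Submodule.sum_mem _ fun β hβ => ?_⟩, ?_⟩
      · rw [MvPolynomial.mem_restrictTotalDegree]
        refine (MvPolynomial.totalDegree_mul _ _).trans (add_le_add
          ((MvPolynomial.mem_restrictTotalDegree _ _ _).1 (hp β)) ?_)
        exact (Finset.single_le_sum (f := fun x => (c β x).totalDegree)
          (fun _ _ => Nat.zero_le _) (Finset.mem_univ x)).trans
          (Finset.single_le_sum (f := fun β => ∑ x, (c β x).totalDegree)
          (fun _ _ => Nat.zero_le _) hβ)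
      · rw [hLapp]
        simp only [LinearMap.comp_apply, Submodule.subtype_apply, LinearMap.mulLeft_apply]
        rw [hpf, Finset.mul_sum]
        simp only [mul_left_comm (MvPolynomial.aeval G b), hc, map_sum, map_mul, Finset.sum_mul,
          Finset.mul_sum]
        rw [Finset.sum_comm]
        simp only [mul_assoc])
  have hB : Function.Injective B := by
    intro f f' h
    have h1 : MvPolynomial.aeval G b * (f : MvPolynomial σ ℂ) =
      MvPolynomial.aeval G b * (f' : MvPolynomial σ ℂ) := congrArg Subtype.val h
    exact Subtype.ext (mul_left_cancel₀ ((map_ne_zero_iff _ hinj).2 hb0) h1)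
  have h := (LinearMap.finrank_le_finrank_of_injective hB).trans (LinearMap.finrank_range_le L)
  rw [Module.finrank_pi_fintype] at h
  simpa [finrank_restrictTotalDegree, hcard] using h

/-- **Bézout's theorem** for a quasi-finite homogeneous map and a reduced fibre. -/
theorem finite_and_ncard_fiber_eq_pow {ι σ : Type*} [Fintype ι] [Fintype σ] {d : ℕ}
    (hd : 0 < d) {G : ι → MvPolynomial σ ℂ} (hG : ∀ i, (G i).IsHomogeneous d)
    (h0 : ∀ x : σ → ℂ, (∀ i, MvPolynomial.eval x (G i) = 0) → x = 0)
    (hcard : Fintype.card ι = Fintype.card σ) {y : ι → ℂ}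
    (hrad : (Ideal.span (Set.range fun i => G i - MvPolynomial.C (y i))).IsRadical) :
    {x : σ → ℂ | ∀ i, MvPolynomial.eval x (G i) = y i}.Finite ∧
      {x : σ → ℂ | ∀ i, MvPolynomial.eval x (G i) = y i}.ncard = d ^ Fintype.card σ := by
  set Z := {x : σ → ℂ | ∀ i, MvPolynomial.eval x (G i) = y i} with hZ
  have hfin : Z.Finite := by
    by_contra hinf
    obtain ⟨F, hFZ, hF⟩ := Set.Infinite.exists_subset_card_eq hinf (d ^ Fintype.card σ + 1)
    have := card_le_pow_of_forall_eval_eq hd hG h0 hcard (fun x hx => hFZ hx)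
    omega
  refine ⟨hfin, ?_⟩
  rw [Set.ncard_eq_toFinset_card Z hfin]
  refine le_antisymm (card_le_pow_of_forall_eval_eq hd hG h0 hcard (y := y) fun x hx => ?_)
    (pow_le_card_of_isRadical hd hG h0 hcard (fun x hx => ?_) hrad)
  · exact (hfin.mem_toFinset.1 hx :)
  · exact hfin.mem_toFinset.2 hx

/-- The antiderivative of a polynomial over a `ℂ`-algebra with vanishing constant term. -/
noncomputable def primitive {S : Type*} [CommRing S] [Algebra ℂ S] (p : S[X]) : S[X] :=
  p.sum fun n a => monomial (n + 1) (algebraMap ℂ S (n + 1 : ℂ)⁻¹ * a)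

section primitive

variable {S : Type*} [CommRing S] [Algebra ℂ S]

theorem coeff_primitive_zero (p : S[X]) : (primitive p).coeff 0 = 0 := by
  simp [primitive, Polynomial.sum, coeff_monomial]

theorem coeff_primitive_succ (p : S[X]) (n : ℕ) :
    (primitive p).coeff (n + 1) = algebraMap ℂ S (n + 1 : ℂ)⁻¹ * p.coeff n := by
  simp only [primitive, Polynomial.sum, finsetSum_coeff, coeff_monomial, add_left_inj]
  rw [Finset.sum_ite_eq' p.support n]
  split_ifs with h
  · rfl
  · rw [notMem_support_iff.1 h, mul_zero]

theorem algebraMap_inv_mul_succ (n : ℕ) :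
    algebraMap ℂ S (n + 1 : ℂ)⁻¹ * ((n : S) + 1) = 1 := by
  have h : (n + 1 : ℂ) ≠ 0 := Nat.cast_add_one_ne_zero n
  calc algebraMap ℂ S (n + 1 : ℂ)⁻¹ * ((n : S) + 1)
      = algebraMap ℂ S ((n + 1 : ℂ)⁻¹ * (n + 1)) := by simp
    _ = 1 := by rw [inv_mul_cancel₀ h, map_one]

theorem derivative_primitive (p : S[X]) : derivative (primitive p) = p := by
  ext n
  rw [coeff_derivative, coeff_primitive_succ, mul_right_comm, algebraMap_inv_mul_succ, one_mul]

theorem map_primitive {S' : Type*} [CommRing S'] [Algebra ℂ S'] (f : S →ₐ[ℂ] S') (p : S[X]) :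
    (primitive p).map (f : S →+* S') = primitive (p.map (f : S →+* S')) := by
  ext n
  rcases n with _ | n
  · simp [coeff_primitive_zero]
  · simp [coeff_primitive_succ]

end primitive

/-- The monic polynomial of degree `m + 2` without constant term whose critical points are `0` and
the `x j`. -/
noncomputable def criticalPoly {S : Type*} [CommRing S] [Algebra ℂ S] {m : ℕ} (x : Fin m → S) :
    S[X] :=
  primitive (((m + 2 : ℕ) : S[X]) * (X * ∏ j, (X - C (x j))))

theorem natDegree_prod_X_sub_C_le {S : Type*} [CommRing S] {m : ℕ} (x : Fin m → S) :
    (∏ j, (X - C (x j))).natDegree ≤ m := by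
  refine (natDegree_prod_le _ _).trans ((Finset.sum_le_card_nsmul Finset.univ _ 1
    fun j _ => natDegree_X_sub_C_le _).trans ?_)
  rw [Finset.card_fin, smul_eq_mul, mul_one]

theorem coeff_prod_X_sub_C_self {S : Type*} [CommRing S] {m : ℕ} (x : Fin m → S) :
    (∏ j, (X - C (x j))).coeff m = 1 := by
  nontriviality S
  have h := monic_prod_X_sub_C x Finset.univ
  have h' : (∏ j, (X - C (x j))).natDegree = m := by simp
  rw [Monic, leadingCoeff, h'] at h
  exact h

section criticalPoly

variable {S : Type*} [CommRing S] [Algebra ℂ S] {m : ℕ}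

theorem derivative_criticalPoly (x : Fin m → S) :
    derivative (criticalPoly x) = ((m + 2 : ℕ) : S[X]) * (X * ∏ j, (X - C (x j))) :=
  derivative_primitive _

theorem map_criticalPoly {S' : Type*} [CommRing S'] [Algebra ℂ S'] (f : S →ₐ[ℂ] S')
    (x : Fin m → S) :
    (criticalPoly x).map (f : S →+* S') = criticalPoly fun j => f (x j) := by
  rw [criticalPoly, map_primitive, criticalPoly]
  simp [Polynomial.map_prod]

theorem coeff_criticalPoly_zero (x : Fin m → S) : (criticalPoly x).coeff 0 = 0 :=
  coeff_primitive_zero _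

theorem coeff_criticalPoly_one (x : Fin m → S) : (criticalPoly x).coeff 1 = 0 := by
  rw [criticalPoly, coeff_primitive_succ, ← C_eq_natCast, coeff_C_mul, coeff_X_mul_zero, mul_zero,
    mul_zero]

theorem coeff_criticalPoly_add_two (x : Fin m → S) (n : ℕ) :
    (criticalPoly x).coeff (n + 2) =
      algebraMap ℂ S (((m : ℂ) + 2) / (n + 2)) * (∏ j, (X - C (x j))).coeff n := by
  rw [criticalPoly, coeff_primitive_succ, ← C_eq_natCast, coeff_C_mul, coeff_X_mul, ← mul_assoc]
  congr 1
  rw [← map_natCast (algebraMap ℂ S), ← map_mul]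
  congr 1
  push_cast
  rw [div_eq_mul_inv, mul_comm, add_assoc, one_add_one_eq_two]

theorem natDegree_criticalPoly_le (x : Fin m → S) : (criticalPoly x).natDegree ≤ m + 2 := by
  rw [natDegree_le_iff_coeff_eq_zero]
  intro N hN
  obtain ⟨n, rfl⟩ : ∃ n, N = n + 2 := ⟨N - 2, by omega⟩
  rw [coeff_criticalPoly_add_two, coeff_eq_zero_of_natDegree_lt
    ((natDegree_prod_X_sub_C_le x).trans_lt (by omega)), mul_zero]

theorem coeff_criticalPoly_self (x : Fin m → S) : (criticalPoly x).coeff (m + 2) = 1 := by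
  rw [coeff_criticalPoly_add_two, coeff_prod_X_sub_C_self, mul_one, div_self, map_one]
  exact_mod_cast Nat.succ_ne_zero (m + 1)

theorem monic_criticalPoly (x : Fin m → S) : (criticalPoly x).Monic :=
  monic_of_natDegree_le_of_coeff_eq_one _ (natDegree_criticalPoly_le x) (coeff_criticalPoly_self x)

end criticalPoly

theorem isHomogeneous_coeff_prod_X_sub_C {σ ι : Type*} (s : Finset ι) (f : ι → σ) (k l : ℕ)
    (h : k + l = s.card) :
    ((∏ j ∈ s, (X - C (MvPolynomial.X (f j) : MvPolynomial σ ℂ))).coeff k).IsHomogeneous l := by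
  classical
  induction s using Finset.induction_on generalizing k l with
  | empty =>
    obtain ⟨rfl, rfl⟩ : k = 0 ∧ l = 0 := by simpa using h
    simpa using MvPolynomial.isHomogeneous_one σ ℂ
  | insert a s ha ih =>
    rw [Finset.card_insert_of_notMem ha] at h
    rw [Finset.prod_insert ha, sub_mul, coeff_sub, coeff_C_mul]
    refine MvPolynomial.IsHomogeneous.sub ?_ ?_
    · rcases k with _ | k
      · rw [coeff_X_mul_zero]
        exact MvPolynomial.isHomogeneous_zero _ _ _
      · rw [coeff_X_mul]
        exact ih k l (by omega)
    · rcases l with _ | l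
      · rw [coeff_eq_zero_of_natDegree_lt, mul_zero]
        · exact MvPolynomial.isHomogeneous_zero _ _ _
        · rw [natDegree_prod_of_monic _ _ fun j _ => monic_X_sub_C _]
          simp
          omega
      · rw [add_comm l]
        exact (MvPolynomial.isHomogeneous_X _ _).mul (ih k l (by omega))

theorem isHomogeneous_eval_criticalPoly {m : ℕ} (i : Fin m) :
    ((criticalPoly (MvPolynomial.X : Fin m → MvPolynomial (Fin m) ℂ)).eval
      (MvPolynomial.X i)).IsHomogeneous (m + 2) := by
  rw [eval_eq_sum_range' (Nat.lt_succ_of_le (natDegree_criticalPoly_le _))]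
  refine MvPolynomial.IsHomogeneous.sum _ _ _ fun k hk => ?_
  rw [Finset.mem_range] at hk
  rcases k with _ | _ | n
  · rw [coeff_criticalPoly_zero, zero_mul]
    exact MvPolynomial.isHomogeneous_zero _ _ _
  · rw [coeff_criticalPoly_one, zero_mul]
    exact MvPolynomial.isHomogeneous_zero _ _ _
  · rw [coeff_criticalPoly_add_two, MvPolynomial.algebraMap_eq]
    have h1 := isHomogeneous_coeff_prod_X_sub_C (Finset.univ : Finset (Fin m)) id n (m - n)
      (by simp; omega)
    have h := (((MvPolynomial.isHomogeneous_C (Fin m) (((m : ℂ) + 2) / (n + 2))).mul h1).mul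
      ((MvPolynomial.isHomogeneous_X ℂ i).pow (n + 2)))
    rwa [show 0 + (m - n) + 1 * (n + 2) = m + 2 by omega] at h

theorem roots_derivative_criticalPoly {m : ℕ} (x : Fin m → ℂ) :
    (derivative (criticalPoly x)).roots = 0 ::ₘ Finset.univ.val.map x := by
  have hm : ((m + 2 : ℕ) : ℂ) ≠ 0 := Nat.cast_ne_zero.2 (by omega)
  have hx : (Finset.univ.val.map fun j => X - C (x j)) =
      (Finset.univ.val.map x).map fun a => X - C a := by
    rw [Multiset.map_map, Function.comp_def]
  rw [derivative_criticalPoly, ← C_eq_natCast, roots_C_mul _ hm, roots_mul, roots_X, Finset.prod,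
    hx, roots_multiset_prod_X_sub_C, Multiset.singleton_add]
  exact mul_ne_zero X_ne_zero (monic_prod_X_sub_C x Finset.univ).ne_zero

theorem eq_zero_of_eval_criticalPoly_eq_zero {m : ℕ} {x : Fin m → ℂ}
    (h : ∀ i, (criticalPoly x).eval (x i) = 0) : x = 0 := by
  classical
  set H := criticalPoly x with hH
  have hH0 : H ≠ 0 := (monic_criticalPoly x).ne_zero
  have hdeg : H.natDegree = m + 2 := by
    refine le_antisymm (natDegree_criticalPoly_le x) (le_natDegree_of_ne_zero ?_)
    rw [hH, coeff_criticalPoly_self]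
    exact one_ne_zero
  have hroots : H.derivative.roots = 0 ::ₘ Finset.univ.val.map x :=
    roots_derivative_criticalPoly x
  have hsub : ∀ z ∈ H.derivative.roots, z ∈ H.roots := by
    intro z hz
    rw [hroots, Multiset.mem_cons, Multiset.mem_map] at hz
    rw [mem_roots hH0, IsRoot.def]
    rcases hz with rfl | ⟨i, -, rfl⟩
    · rw [← coeff_zero_eq_eval_zero, hH, coeff_criticalPoly_zero]
    · exact h i
  have hle : H.derivative.roots + H.roots.dedup ≤ H.roots := by
    rw [Multiset.le_iff_count]
    intro z
    rw [Multiset.count_add, Multiset.count_dedup]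
    split_ifs with hz
    · rw [count_roots, count_roots, derivative_rootMultiplicity_of_root ((mem_roots hH0).1 hz)]
      have := (rootMultiplicity_pos hH0).2 ((mem_roots hH0).1 hz)
      omega
    · rw [Multiset.count_eq_zero.2 fun hz' => hz (hsub z hz')]
      exact Nat.zero_le _
  have hcard := (Multiset.card_le_card hle).trans (card_roots' H)
  rw [hroots, Multiset.card_add, Multiset.card_cons, Multiset.card_map, hdeg] at hcard
  have hcard' : H.roots.toFinset.card ≤ 1 := by
    rw [Multiset.card_toFinset]
    simp at hcard
    omega
  ext i
  refine Finset.card_le_one.1 hcard' _ ?_ _ ?_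
  · rw [Multiset.mem_toFinset]
    refine hsub _ ?_
    simp [hroots]
  · rw [Multiset.mem_toFinset]
    refine hsub _ ?_
    simp [hroots]

theorem eq_of_eval_criticalPoly_eq {S : Type*} [CommRing S] [Algebra ℂ S] {m : ℕ} {y : Fin m → ℂ}
    (hy : Function.Injective y) (hy0 : ∀ i, y i ≠ 0) {x x' : Fin m → S}
    (hx : ∀ i, (criticalPoly x).eval (x i) = algebraMap ℂ S (y i))
    (hx' : ∀ i, (criticalPoly x').eval (x' i) = algebraMap ℂ S (y i))
    (hsq : ∀ i, (x i - x' i) ^ 2 = 0) : x = x' := by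
  nontriviality S
  have hunit : ∀ c : ℂ, c ≠ 0 → IsUnit (algebraMap ℂ S c) := fun c hc =>
    (isUnit_iff_ne_zero.2 hc).map _
  have hx1 : ∀ i, (criticalPoly x').eval (x i) = algebraMap ℂ S (y i) := by
    intro i
    have h := eval_add_of_sq_eq_zero (criticalPoly x') (x' i) (x i - x' i) (hsq i)
    rw [add_sub_cancel, hx', derivative_criticalPoly, eval_mul, eval_mul, eval_prod,
      Finset.prod_eq_zero (Finset.mem_univ i) (by simp), mul_zero, mul_zero, zero_mul,
      add_zero] at h
    exact h
  have hxu : ∀ i, IsUnit (x i) := by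
    intro i
    refine isUnit_of_dvd_unit ?_ (hunit _ (hy0 i))
    have h := sub_dvd_eval_sub (x i) 0 (criticalPoly x)
    rwa [sub_zero, hx, ← coeff_zero_eq_eval_zero, coeff_criticalPoly_zero, sub_zero] at h
  have hxx : ∀ i j, i ≠ j → IsUnit (x i - x j) := by
    intro i j hij
    refine isUnit_of_dvd_unit ?_ (hunit _ (sub_ne_zero.2 (hy.ne hij)))
    have h := sub_dvd_eval_sub (x i) (x j) (criticalPoly x)
    rwa [hx, hx, ← map_sub] at h
  have hxx' : ∀ i j, i ≠ j → IsUnit (x i - x' j) := by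
    intro i j hij
    refine isUnit_of_dvd_unit ?_ (hunit _ (sub_ne_zero.2 (hy.ne hij)))
    have h := sub_dvd_eval_sub (x i) (x' j) (criticalPoly x')
    rwa [hx1, hx', ← map_sub] at h
  have hdvd : X ^ 2 * ∏ i, (X - C (x i)) ∣ criticalPoly x' - criticalPoly x := by
    refine IsCoprime.mul_dvd ?_ ?_ ?_
    · refine IsCoprime.pow_left (IsCoprime.prod_right fun i _ => ?_)
      simpa using isCoprime_X_sub_C_of_isUnit_sub (a := 0) (b := x i) (by simpa using hxu i)
    · rw [X_pow_dvd_iff]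
      intro k hk
      rw [coeff_sub]
      interval_cases k
      · simp [coeff_criticalPoly_zero]
      · simp [coeff_criticalPoly_one]
    · refine Finset.prod_dvd_of_coprime (fun i _ j _ hij => ?_) fun i _ => ?_
      · exact isCoprime_X_sub_C_of_isUnit_sub (hxx i j hij)
      · rw [dvd_iff_isRoot, IsRoot.def, eval_sub, hx, hx1, sub_self]
  have hQ : criticalPoly x' = criticalPoly x := by
    by_contra hne
    have hmon : (X ^ 2 * ∏ i, (X - C (x i))).Monic :=
      (monic_X_pow 2).mul (monic_prod_X_sub_C x Finset.univ)
    refine hmon.not_dvd_of_natDegree_lt (sub_ne_zero.2 hne) ?_ hdvd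
    rw [(monic_X_pow 2).natDegree_mul (monic_prod_X_sub_C x Finset.univ), natDegree_X_pow,
      natDegree_finsetProd_X_sub_C_eq_card, Finset.card_fin]
    refine Nat.lt_of_le_of_ne ((natDegree_sub_le_of_le (natDegree_criticalPoly_le x')
      (natDegree_criticalPoly_le x)).trans (by simp; omega)) fun h => ?_
    refine sub_ne_zero.2 hne (leadingCoeff_eq_zero.1 ?_)
    rw [leadingCoeff, h, add_comm 2, coeff_sub, coeff_criticalPoly_self, coeff_criticalPoly_self,
      sub_self]
  funext i
  have h : (derivative (criticalPoly x')).eval (x i) = 0 := by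
    rw [hQ, derivative_criticalPoly, eval_mul, eval_mul, eval_prod,
      Finset.prod_eq_zero (Finset.mem_univ i) (by simp), mul_zero, mul_zero]
  rw [derivative_criticalPoly, eval_mul, eval_mul, eval_prod,
    ← Finset.mul_prod_erase _ _ (Finset.mem_univ i), eval_natCast, eval_X] at h
  have hm : IsUnit ((m + 2 : ℕ) : S) := by
    rw [← map_natCast (algebraMap ℂ S)]
    exact hunit _ (Nat.cast_ne_zero.2 (by omega))
  have hp : IsUnit (∏ j ∈ Finset.univ.erase i, eval (x i) (X - C (x' j))) := by
    rw [IsUnit.prod_iff]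
    intro j hj
    rw [eval_sub, eval_X, eval_C]
    exact hxx' i j (Finset.ne_of_mem_erase hj).symm
  rw [hm.mul_right_eq_zero, (hxu i).mul_right_eq_zero, hp.mul_left_eq_zero, eval_sub, eval_X,
    eval_C, sub_eq_zero] at h
  exact h

theorem isRadical_span_eval_criticalPoly {m : ℕ} {y : Fin m → ℂ}
    (hy : Function.Injective y) (hy0 : ∀ i, y i ≠ 0) :
    (Ideal.span (Set.range fun i => (criticalPoly (MvPolynomial.X : Fin m → MvPolynomial (Fin m) ℂ)
      ).eval (MvPolynomial.X i) - MvPolynomial.C (y i))).IsRadical := by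
  set I := Ideal.span (Set.range fun i =>
    (criticalPoly (MvPolynomial.X : Fin m → MvPolynomial (Fin m) ℂ)).eval (MvPolynomial.X i) -
      MvPolynomial.C (y i)) with hI
  have key : ∀ {S : Type} [CommRing S] [Algebra ℂ S] (f : MvPolynomial (Fin m) ℂ ⧸ I →ₐ[ℂ] S) i,
      (criticalPoly fun j => f (Ideal.Quotient.mk I (MvPolynomial.X j))).eval
        (f (Ideal.Quotient.mk I (MvPolynomial.X i))) = algebraMap ℂ S (y i) := by
    intro S _ _ f i
    have h := map_criticalPoly (f.comp (Ideal.Quotient.mkₐ ℂ I)) MvPolynomial.X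
    have h' : (f.comp (Ideal.Quotient.mkₐ ℂ I)) ((criticalPoly (MvPolynomial.X : Fin m →
        MvPolynomial (Fin m) ℂ)).eval (MvPolynomial.X i)) =
        f.comp (Ideal.Quotient.mkₐ ℂ I) (MvPolynomial.C (y i)) := by
      simp only [AlgHom.comp_apply, Ideal.Quotient.mkₐ_eq_mk]
      congr 1
      rw [Ideal.Quotient.mk_eq_mk_iff_sub_mem, hI]
      exact Ideal.subset_span ⟨i, rfl⟩
    rw [← MvPolynomial.algebraMap_eq, AlgHom.commutes, ← RingHom.coe_coe, ← eval_map_apply, h] at h'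
    exact h'
  have : Algebra.FormallyUnramified ℂ (MvPolynomial (Fin m) ℂ ⧸ I) := by
    rw [Algebra.FormallyUnramified.iff_comp_injective]
    intro S _ _ J hJ f g hfg
    have hfg' : (fun j => f (Ideal.Quotient.mk I (MvPolynomial.X j))) =
        fun j => g (Ideal.Quotient.mk I (MvPolynomial.X j)) := by
      refine eq_of_eval_criticalPoly_eq hy hy0 (key f) (key g) fun i => ?_
      rw [← Ideal.mem_bot, ← hJ]
      refine Ideal.pow_mem_pow ?_ 2
      rw [← Ideal.Quotient.mk_eq_mk_iff_sub_mem]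
      exact DFunLike.congr_fun hfg _
    refine Ideal.Quotient.algHom_ext _ (MvPolynomial.algHom_ext fun j => ?_)
    exact congrFun hfg' j
  rw [Ideal.isRadical_iff_quotient_reduced]
  exact Algebra.FormallyUnramified.isReduced_of_field ℂ _

theorem coeff_mcPoly_add_two (m : ℕ) (a : Fin (m + 1) → ℂ) (k : ℕ) :
    (mcPoly (m + 2) a).coeff k =
      (if k = m + 2 then 1 else 0) + if h : k < m + 1 then a ⟨k, h⟩ else 0 := by
  have h : ∀ i : Fin (m + 1), (C (a i) * X ^ (i : ℕ)).coeff k = if k = i then a i else 0 := by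
    intro i
    rw [coeff_C_mul, coeff_X_pow, mul_ite, mul_one, mul_zero]
  change (X ^ (m + 2) + ∑ i : Fin (m + 1), C (a i) * X ^ (i : ℕ)).coeff k = _
  rw [coeff_add, coeff_X_pow, finsetSum_coeff]
  simp only [h]
  congr 1
  split_ifs with hk
  · rw [Finset.sum_eq_single ⟨k, hk⟩]
    · simp
    · intro i _ hi
      rw [if_neg]
      rintro rfl
      exact hi rfl
    · simp
  · refine Finset.sum_eq_zero fun i _ => if_neg ?_
    have := i.isLt
    omega

theorem mcPoly_coeff {m : ℕ} {q : ℂ[X]} (hq : q.natDegree ≤ m + 2) (h2 : q.coeff (m + 2) = 1)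
    (h1 : q.coeff (m + 1) = 0) : mcPoly (m + 2) (fun i => q.coeff i) = q := by
  ext k
  rw [coeff_mcPoly_add_two]
  rcases lt_trichotomy k (m + 1) with hk | rfl | hk
  · rw [if_neg (by omega), dif_pos hk, zero_add]
  · simp [h1]
  · rw [dif_neg (by omega), add_zero]
    split_ifs with hk'
    · rw [hk', h2]
    · rw [coeff_eq_zero_of_natDegree_lt (by omega)]

theorem mcPoly_add_two_injective (m : ℕ) :
    Function.Injective (mcPoly (m + 2) : (Fin (m + 1) → ℂ) → ℂ[X]) := by
  intro a b hab
  funext i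
  have h := congrArg (fun p => p.coeff i) hab
  simp only [coeff_mcPoly_add_two, add_right_inj] at h
  have hi : (i : ℕ) < m + 1 := i.isLt
  rwa [dif_pos hi, dif_pos hi] at h

theorem eq_of_derivative_eq_of_eval_eq {p q : ℂ[X]} (h : derivative p = derivative q) {z : ℂ}
    (hz : p.eval z = q.eval z) : p = q := by
  have h' : derivative (p - q) = 0 := by rw [derivative_sub, h, sub_self]
  rw [← sub_eq_zero, eq_C_of_derivative_eq_zero h', C_eq_zero]
  have h0 : (p - q).eval z = 0 := by rw [eval_sub, hz, sub_self]
  rwa [eq_C_of_derivative_eq_zero h', eval_C] at h0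

/-- The points with barycentre `0` whose differences to the first one are the `x j`. -/
noncomputable def centeredPoints {m : ℕ} (x : Fin m → ℂ) : Fin (m + 1) → ℂ :=
  Fin.cons (-(∑ j, x j) / (m + 1)) fun j => -(∑ j, x j) / (m + 1) + x j

theorem sum_centeredPoints {m : ℕ} (x : Fin m → ℂ) : ∑ i, centeredPoints x i = 0 := by
  have h : (m + 1 : ℂ) ≠ 0 := Nat.cast_add_one_ne_zero m
  rw [centeredPoints, Fin.sum_cons, Finset.sum_add_distrib, Finset.sum_const, Finset.card_fin,
    nsmul_eq_mul]
  field_simp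
  ring

theorem centeredPoints_succ {m : ℕ} (x : Fin m → ℂ) (j : Fin m) :
    centeredPoints x j.succ = centeredPoints x 0 + x j := by
  simp [centeredPoints]

theorem centeredPoints_sub {m : ℕ} {z : Fin (m + 1) → ℂ} (hz : ∑ i, z i = 0) :
    centeredPoints (fun j => z j.succ - z 0) = z := by
  have h : (m + 1 : ℂ) ≠ 0 := Nat.cast_add_one_ne_zero m
  have h0 : -(∑ j : Fin m, (z j.succ - z 0)) / (m + 1) = z 0 := by
    rw [Fin.sum_univ_succ] at hz
    rw [Finset.sum_sub_distrib, Finset.sum_const, Finset.card_fin, nsmul_eq_mul, div_eq_iff h]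
    linear_combination -hz
  funext i
  refine Fin.cases ?_ (fun j => ?_) i
  · rw [centeredPoints, Fin.cons_zero, h0]
  · rw [centeredPoints, Fin.cons_succ, h0, add_sub_cancel]

/-- The monic centered polynomial with critical points `centeredPoints x` and value `w` at the
first of them. -/
noncomputable def centeredPoly {m : ℕ} (w : ℂ) (x : Fin m → ℂ) : ℂ[X] :=
  (criticalPoly x + C w).comp (X - C (centeredPoints x 0))

section centeredPoly

variable {m : ℕ} (w : ℂ) (x : Fin m → ℂ)

theorem derivative_centeredPoly :
    derivative (centeredPoly w x) = C (m + 2 : ℂ) * ∏ i, (X - C (centeredPoints x i)) := by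
  rw [centeredPoly, derivative_comp, derivative_add, derivative_criticalPoly, derivative_C,
    add_zero, derivative_sub, derivative_X, derivative_C, sub_zero, one_mul, mul_comp, mul_comp,
    X_comp, prod_comp, Fin.prod_univ_succ, natCast_comp]
  congr 1
  · rw [← C_eq_natCast]
    push_cast
    rfl
  · congr 1
    refine Finset.prod_congr rfl fun j _ => ?_
    rw [sub_comp, X_comp, C_comp, centeredPoints_succ, C_add, sub_sub]

theorem eval_centeredPoly_zero : (centeredPoly w x).eval (centeredPoints x 0) = w := by
  simp [centeredPoly, ← coeff_zero_eq_eval_zero, coeff_criticalPoly_zero]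

theorem eval_centeredPoly_succ (j : Fin m) :
    (centeredPoly w x).eval (centeredPoints x j.succ) = (criticalPoly x).eval (x j) + w := by
  simp [centeredPoly, centeredPoints_succ]

theorem mcPoly_coeff_centeredPoly :
    mcPoly (m + 2) (fun i => (centeredPoly w x).coeff i) = centeredPoly w x := by
  have hcard : (Finset.univ : Finset (Fin (m + 1))).card = m + 1 := Finset.card_fin _
  refine mcPoly_coeff ?_ ?_ ?_
  · rw [centeredPoly, natDegree_comp, natDegree_X_sub_C, mul_one, natDegree_add_C]
    exact natDegree_criticalPoly_le x
  · have h := congrArg (fun p => p.coeff (m + 1)) (derivative_centeredPoly w x)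
    simp only [coeff_derivative, coeff_C_mul, coeff_prod_X_sub_C_self, mul_one] at h
    have h2 : (m + 2 : ℂ) ≠ 0 := by exact_mod_cast Nat.succ_ne_zero (m + 1)
    refine mul_right_cancel₀ h2 ?_
    push_cast at h
    linear_combination h
  · have h := congrArg (fun p => p.coeff m) (derivative_centeredPoly w x)
    have h' := prod_X_sub_C_coeff_card_pred Finset.univ (centeredPoints x) (by simp)
    rw [hcard, Nat.add_sub_cancel, sum_centeredPoints, neg_zero] at h'
    simp only [coeff_derivative, coeff_C_mul, h', mul_zero] at h
    exact (mul_eq_zero.1 h).resolve_right (Nat.cast_add_one_ne_zero m)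

theorem roots_derivative_centeredPoly :
    (derivative (centeredPoly w x)).roots = Finset.univ.val.map (centeredPoints x) := by
  have h2 : (m + 2 : ℂ) ≠ 0 := by exact_mod_cast Nat.succ_ne_zero (m + 1)
  have hx : (Finset.univ.val.map fun j => X - C (centeredPoints x j)) =
      (Finset.univ.val.map (centeredPoints x)).map fun a => X - C a := by
    rw [Multiset.map_map, Function.comp_def]
  rw [derivative_centeredPoly, roots_C_mul _ h2, Finset.prod, hx, roots_multiset_prod_X_sub_C]

end centeredPoly

theorem exists_roots_eq_map_of_cvl_eq {m : ℕ} {v : Fin (m + 1) → ℂ} (hv : Function.Injective v)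
    {p : ℂ[X]} (h : cvl p = Finset.univ.val.map v) :
    ∃ z : Fin (m + 1) → ℂ, p.derivative.roots = Finset.univ.val.map z ∧
      ∀ i, p.eval (z i) = v i := by
  have hz : ∀ i, ∃ z ∈ p.derivative.roots, p.eval z = v i := by
    intro i
    rw [← Multiset.mem_map, ← cvl, h]
    exact Multiset.mem_map_of_mem v (Finset.mem_univ i)
  choose z hz hzv using hz
  refine ⟨z, (Multiset.eq_of_le_of_card_le ?_ ?_).symm, hzv⟩
  · rw [Multiset.le_iff_subset]
    · intro a ha
      obtain ⟨i, -, rfl⟩ := Multiset.mem_map.1 ha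
      exact hz i
    · refine Finset.univ.nodup.map fun i j hij => hv ?_
      rw [← hzv, ← hzv, hij]
  · have h' := congrArg Multiset.card h
    rw [cvl, Multiset.card_map, Multiset.card_map] at h'
    rw [Multiset.card_map, h']

theorem exists_eq_centeredPoly {m : ℕ} {v : Fin (m + 1) → ℂ} (hv : Function.Injective v)
    {a : Fin (m + 1) → ℂ} (h : cvl (mcPoly (m + 2) a) = Finset.univ.val.map v) :
    ∃ x : Fin m → ℂ, (∀ i, (criticalPoly x).eval (x i) = v i.succ - v 0) ∧
      mcPoly (m + 2) a = centeredPoly (v 0) x := by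
  obtain ⟨z, hz, hzv⟩ := exists_roots_eq_map_of_cvl_eq hv h
  set p := mcPoly (m + 2) a with hp
  have hder : derivative p = C (m + 2 : ℂ) * ∏ i, (X - C (z i)) := by
    have h1 := C_leadingCoeff_mul_prod_multiset_X_sub_C (p := derivative p)
      (splits_iff_card_roots.1 (IsAlgClosed.splits _))
    have hdeg : (derivative p).natDegree = m + 1 := by
      rw [← splits_iff_card_roots.1 (IsAlgClosed.splits _), hz]
      simp
    rw [hz, Multiset.map_map, leadingCoeff, hdeg, coeff_derivative, hp, coeff_mcPoly_add_two] at h1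
    rw [← h1]
    congr 2
    simp
    ring
  have hsum : ∑ i, z i = 0 := by
    have h1 := congrArg (fun p => p.coeff m) hder
    have h' := prod_X_sub_C_coeff_card_pred Finset.univ z (by simp)
    rw [Finset.card_fin, Nat.add_sub_cancel] at h'
    simp only [coeff_derivative, coeff_C_mul, h', hp, coeff_mcPoly_add_two] at h1
    have h2 : (m + 2 : ℂ) ≠ 0 := by exact_mod_cast Nat.succ_ne_zero (m + 1)
    simpa [h2] using h1
  have hx := centeredPoints_sub hsum
  set x : Fin m → ℂ := fun j => z j.succ - z 0 with hxdef
  have hpx : p = centeredPoly (v 0) x := by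
    refine eq_of_derivative_eq_of_eval_eq (z := z 0) ?_ ?_
    · rw [hder, derivative_centeredPoly, hx]
    · rw [hzv, ← hx, eval_centeredPoly_zero]
  refine ⟨x, fun i => ?_, hpx⟩
  rw [eq_sub_iff_add_eq, ← eval_centeredPoly_succ, hx, ← hpx, hzv]

theorem eval_centeredPoly {m : ℕ} {v : Fin (m + 1) → ℂ} {x : Fin m → ℂ}
    (hx : ∀ i, (criticalPoly x).eval (x i) = v i.succ - v 0) (i : Fin (m + 1)) :
    (centeredPoly (v 0) x).eval (centeredPoints x i) = v i := by
  refine Fin.cases ?_ (fun j => ?_) i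
  · rw [eval_centeredPoly_zero]
  · rw [eval_centeredPoly_succ, hx, sub_add_cancel]

theorem cvl_centeredPoly {m : ℕ} {v : Fin (m + 1) → ℂ} {x : Fin m → ℂ}
    (hx : ∀ i, (criticalPoly x).eval (x i) = v i.succ - v 0) :
    cvl (centeredPoly (v 0) x) = Finset.univ.val.map v := by
  rw [cvl, roots_derivative_centeredPoly, Multiset.map_map]
  exact Multiset.map_congr rfl fun i _ => eval_centeredPoly hx i

theorem eq_of_centeredPoly_eq {m : ℕ} {v : Fin (m + 1) → ℂ} (hv : Function.Injective v)
    {x x' : Fin m → ℂ} (hx : ∀ i, (criticalPoly x).eval (x i) = v i.succ - v 0)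
    (hx' : ∀ i, (criticalPoly x').eval (x' i) = v i.succ - v 0)
    (h : centeredPoly (v 0) x = centeredPoly (v 0) x') : x = x' := by
  have hz : ∀ i, centeredPoints x i = centeredPoints x' i := by
    intro i
    have hi : centeredPoints x i ∈ Finset.univ.val.map (centeredPoints x') := by
      rw [← roots_derivative_centeredPoly (v 0), ← h, roots_derivative_centeredPoly]
      exact Multiset.mem_map_of_mem _ (Finset.mem_univ i)
    obtain ⟨k, -, hk⟩ := Multiset.mem_map.1 hi
    have hki : v k = v i := by
      rw [← eval_centeredPoly hx' k, ← eval_centeredPoly hx i, hk, h]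
    rw [← hk, hv hki]
  funext j
  have hj := hz j.succ
  rwa [centeredPoints_succ, centeredPoints_succ, hz 0, add_right_inj] at hj

theorem finite_and_ncard_eval_criticalPoly {m : ℕ} {v : Fin (m + 1) → ℂ}
    (hv : Function.Injective v) :
    {x : Fin m → ℂ | ∀ i, (criticalPoly x).eval (x i) = v i.succ - v 0}.Finite ∧
      {x : Fin m → ℂ | ∀ i, (criticalPoly x).eval (x i) = v i.succ - v 0}.ncard =
        (m + 2) ^ m := by
  have heval : ∀ (x : Fin m → ℂ) (i : Fin m), MvPolynomial.eval x ((criticalPoly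
      (MvPolynomial.X : Fin m → MvPolynomial (Fin m) ℂ)).eval (MvPolynomial.X i)) =
      (criticalPoly x).eval (x i) := by
    intro x i
    have h := map_criticalPoly (MvPolynomial.aeval x) MvPolynomial.X
    rw [← MvPolynomial.coe_aeval_eq_eval, ← eval_map_apply, h]
    simp
  have h := finite_and_ncard_fiber_eq_pow (Nat.succ_pos (m + 1)) (y := fun i => v i.succ - v 0)
    isHomogeneous_eval_criticalPoly (fun x hx => eq_zero_of_eval_criticalPoly_eq_zero fun i => by
      rw [← heval, hx]) rfl
    (isRadical_span_eval_criticalPoly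
      (fun i j hij => Fin.succ_injective _ (hv (sub_left_injective hij)))
      fun i => sub_ne_zero.2 (hv.ne (Fin.succ_ne_zero i)))
  simpa only [heval, Fintype.card_fin] using h

/-- The Lyashko–Looijenga map is a finite map of degree `d^(d-2)`: a generic multiset of
`d-1` distinct critical values has exactly `d^(d-2)` preimages among monic centered
degree-`d` polynomials. -/
theorem stmt_16 (d : ℕ) (hd : 2 ≤ d) (T : Finset ℂ) (hT : T.card = d - 1) :
    {a : Fin (d - 1) → ℂ | cvl (mcPoly d a) = T.val}.Finite ∧
      {a : Fin (d - 1) → ℂ | cvl (mcPoly d a) = T.val}.ncard = d ^ (d - 2) := by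
  obtain ⟨m, rfl⟩ : ∃ m, d = m + 2 := ⟨d - 2, by omega⟩
  change {a : Fin (m + 1) → ℂ | cvl (mcPoly (m + 2) a) = T.val}.Finite ∧
    {a : Fin (m + 1) → ℂ | cvl (mcPoly (m + 2) a) = T.val}.ncard = (m + 2) ^ m
  let e : Fin (m + 1) ≃ T := (T.equivFinOfCardEq hT).symm
  set v : Fin (m + 1) → ℂ := fun i => e i with hvdef
  have hv : Function.Injective v := Subtype.val_injective.comp e.injective
  have hTv : T.val = Finset.univ.val.map v := by
    have h : T = Finset.univ.map ⟨v, hv⟩ := by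
      ext w
      rw [Finset.mem_map]
      exact ⟨fun hw => ⟨e.symm ⟨w, hw⟩, Finset.mem_univ _, by simp [hvdef]⟩,
        by rintro ⟨i, -, rfl⟩; exact (e i).2⟩
    rw [h, Finset.map_val]
    rfl
  rw [hTv]
  obtain ⟨hfin, hcard⟩ := finite_and_ncard_eval_criticalPoly hv
  set F := {x : Fin m → ℂ | ∀ i, (criticalPoly x).eval (x i) = v i.succ - v 0} with hF
  have himage : {a : Fin (m + 1) → ℂ | cvl (mcPoly (m + 2) a) = Finset.univ.val.map v} =
      (fun x (i : Fin (m + 1)) => (centeredPoly (v 0) x).coeff i) '' F := by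
    ext a
    constructor
    · intro ha
      obtain ⟨x, hx, hax⟩ := exists_eq_centeredPoly hv ha
      refine ⟨x, hx, mcPoly_add_two_injective m ?_⟩
      rw [hax]
      exact mcPoly_coeff_centeredPoly _ _
    · rintro ⟨x, hx, rfl⟩
      exact (congrArg cvl (mcPoly_coeff_centeredPoly _ _)).trans (cvl_centeredPoly hx)
  rw [himage]
  refine ⟨hfin.image _, ?_⟩
  rw [Set.InjOn.ncard_image, hcard]
  intro x hx x' hx' h
  refine eq_of_centeredPoly_eq hv hx hx' ?_
  rw [← mcPoly_coeff_centeredPoly, ← mcPoly_coeff_centeredPoly (v 0) x']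
  exact congrArg (mcPoly (m + 2)) h
end

section
/- Let d ≥ 2, let c ∈ ℂ, and let p ∈ ℂ[X] be monic with natDegree p = d and with vanishing coefficient of X^{d−1} (monic and centered). If every critical value of p equals c, i.e. for every z : ℂ with p.derivative.IsRoot z one has p.eval z = c, then p = X^d + C c. (The polynomial z^d + c is the unique monic centered degree-d polynomial with indiscrete critical value multiset {c^{d−1}}.) -/
open Polynomial

/-- A polynomial over an algebraically closed field of characteristic zero, all of whose critical
points are roots, has exactly one distinct root. -/
theorem card_toFinset_roots_of_derivative_isRoot {K : Type*} [Field K] [IsAlgClosed K] [CharZero K]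
    [DecidableEq K] {q : K[X]} (hq : q.natDegree ≠ 0)
    (h : ∀ z, q.derivative.IsRoot z → q.IsRoot z) : q.roots.toFinset.card = 1 := by
  have hq0 : q ≠ 0 := by rintro rfl; simp at hq
  have hd0 : q.derivative ≠ 0 := fun h0 => hq (derivative_eq_zero.1 h0)
  have hsub : q.derivative.roots.toFinset ⊆ q.roots.toFinset := by
    intro z hz
    rw [Multiset.mem_toFinset, mem_roots hd0] at hz
    rw [Multiset.mem_toFinset, mem_roots hq0]
    exact h z hz
  have hcard : q.roots.card = q.natDegree := (IsAlgClosed.splits q).natDegree_eq_card_roots.symm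
  have hcard' : q.derivative.roots.card = q.natDegree - 1 := by
    rw [← (IsAlgClosed.splits q.derivative).natDegree_eq_card_roots, natDegree_derivative]
  have hsum : ∑ z ∈ q.roots.toFinset, q.roots.count z = q.roots.card :=
    Multiset.toFinset_sum_count_eq _
  have hsum' : ∑ z ∈ q.roots.toFinset, q.derivative.roots.count z = q.derivative.roots.card :=
    Multiset.sum_count_eq_card fun z hz => hsub (Multiset.mem_toFinset.2 hz)
  have hcount : ∑ z ∈ q.roots.toFinset, q.roots.count z =
      ∑ z ∈ q.roots.toFinset, (q.derivative.roots.count z + 1) := by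
    refine Finset.sum_congr rfl fun z hz => ?_
    rw [Multiset.mem_toFinset] at hz
    have hpos := Multiset.count_pos.2 hz
    rw [count_roots] at hpos
    rw [count_roots, count_roots, derivative_rootMultiplicity_of_root (isRoot_of_mem_roots hz)]
    omega
  rw [Finset.sum_add_distrib, Finset.sum_const, smul_eq_mul, mul_one] at hcount
  omega

/-- A monic centered polynomial with a single distinct root over an algebraically closed field of
characteristic zero is a power of `X`. -/
theorem Polynomial.Monic.eq_X_pow_of_card_toFinset_roots {K : Type*} [Field K] [IsAlgClosed K]
    [CharZero K] [DecidableEq K] {q : K[X]} (hm : q.Monic) (hnext : q.nextCoeff = 0)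
    (hq : q.roots.toFinset.card = 1) : q = X ^ q.natDegree := by
  obtain ⟨a, ha⟩ := Finset.card_eq_one.1 hq
  have hs := IsAlgClosed.splits q
  have hrep : q.roots = Multiset.replicate q.natDegree a := by
    refine Multiset.eq_replicate.2 ⟨hs.natDegree_eq_card_roots.symm, fun b hb => ?_⟩
    rwa [← Multiset.mem_toFinset, ha, Finset.mem_singleton] at hb
  have hdeg : q.natDegree ≠ 0 := by
    intro h0
    simp [hrep, h0] at hq
  have ha0 : a = 0 := by
    rw [hs.nextCoeff_eq_neg_sum_roots_of_monic hm, hrep] at hnext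
    simpa [hdeg] using hnext
  have hprod := hs.eq_prod_roots_of_monic hm
  rw [hrep, ha0] at hprod
  simpa using hprod

/-- `z^d + c` is the unique monic centered degree-`d` polynomial all of whose critical
values equal `c`. -/
theorem stmt_17 (d : ℕ) (hd : 2 ≤ d) (c : ℂ) (p : ℂ[X])
    (hmonic : p.Monic) (hdeg : p.natDegree = d) (hcent : p.coeff (d - 1) = 0)
    (hcv : ∀ z : ℂ, p.derivative.IsRoot z → p.eval z = c) :
    p = X ^ d + C c := by
  have hqdeg : (p - C c).natDegree = d := by rw [natDegree_sub_C, hdeg]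
  have hqm : (p - C c).Monic := by
    rw [Monic, leadingCoeff, hqdeg, coeff_sub, coeff_C_of_ne_zero (by omega), sub_zero, ← hdeg]
    exact hmonic
  have hnext : (p - C c).nextCoeff = 0 := by
    rw [nextCoeff_of_natDegree_pos (by omega), hqdeg, coeff_sub, hcent,
      coeff_C_of_ne_zero (by omega), sub_zero]
  have hcard : (p - C c).roots.toFinset.card = 1 := by
    refine card_toFinset_roots_of_derivative_isRoot (by omega) fun z hz => ?_
    rw [derivative_sub, derivative_C, sub_zero] at hz
    simp [hcv z hz]
  have hX := hqm.eq_X_pow_of_card_toFinset_roots hnext hcard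
  rw [hqdeg] at hX
  exact sub_eq_iff_eq_add.1 hX
end

section
/- Let p ∈ ℂ[X] with d := p.natDegree ≥ 1 and p ≠ 0, let w ∈ ℂ and r ≥ 0, and suppose the boundary circle is regular: for every z : ℂ with p.derivative.IsRoot z one has p.eval z ∉ Metric.sphere w r. Let n_w := Multiset.card ((p.derivative.roots).filter (fun z => p.eval z ∈ Metric.closedBall w r)) be the total multiplicity of the critical points of p whose critical values lie in the closed disk Metric.closedBall w r. Then the preimage (fun z => p.eval z) ⁻¹' (Metric.closedBall w r), as a topological subspace of ℂ, has exactly d − n_w connected components: Nat.card (ConnectedComponents of that subspace) = d − n_w. -/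
open Polynomial

section Topology

open Set Filter Topology

/-- If `f` is a continuous open map and `G` is an open set such that `f` restricts to a proper map
`G → E` with `E` preconnected, then every connected component of `G` is mapped onto `E`. -/
lemma subset_image_connectedComponentIn {X Y : Type*} [TopologicalSpace X] [TopologicalSpace Y]
    [LocallyConnectedSpace X] [T2Space Y] {f : X → Y} (hc : Continuous f) (ho : IsOpenMap f)
    {G : Set X} {E : Set Y} (hG : IsOpen G) (hGc : IsCompact (closure G)) (hE : IsPreconnected E)
    (hfG : MapsTo f G E) (hbd : ∀ z ∈ closure G, f z ∈ E → z ∈ G) {x : X} (hx : x ∈ G) :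
    E ⊆ f '' connectedComponentIn G x := by
  set W := connectedComponentIn G x with hW
  have hWG : W ⊆ G := connectedComponentIn_subset G x
  have hWo : IsOpen W := hG.connectedComponentIn
  have hWc : IsCompact (closure W) := hGc.of_isClosed_subset isClosed_closure (closure_mono hWG)
  have hxW : x ∈ W := mem_connectedComponentIn hx
  have hWcl : ∀ y ∈ closure W, y ∈ G → y ∈ W := by
    intro y hy hyG
    obtain ⟨z, hz, hzW⟩ := mem_closure_iff.1 hy _ (hG.connectedComponentIn (x := y))
      (mem_connectedComponentIn hyG)
    rw [hW, connectedComponentIn_eq hzW, ← connectedComponentIn_eq hz]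
    exact mem_connectedComponentIn hyG
  refine hE.subset_left_of_subset_union (ho _ hWo) (hWc.image hc).isClosed.isOpen_compl ?_ ?_
    ⟨f x, hfG hx, mem_image_of_mem f hxW⟩
  · exact disjoint_compl_right.mono_left (image_mono subset_closure)
  · intro e he
    by_cases h : e ∈ f '' closure W
    · obtain ⟨y, hy, rfl⟩ := h
      exact Or.inl ⟨y, hWcl y hy (hbd y (closure_mono hWG hy) he), rfl⟩
    · exact Or.inr h

/-- Distinct connected components of a compact Hausdorff set are separated by open sets covering
it. -/
lemma IsCompact.exists_isOpen_separation_of_notMem_connectedComponentIn {X : Type*}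
    [TopologicalSpace X] [T2Space X] {F : Set X} (hF : IsCompact F) {a b : X} (ha : a ∈ F)
    (hb : b ∈ F) (hab : b ∉ connectedComponentIn F a) :
    ∃ u v : Set X, IsOpen u ∧ IsOpen v ∧ Disjoint u v ∧ F ⊆ u ∪ v ∧ a ∈ u ∧ b ∈ v := by
  have : CompactSpace F := isCompact_iff_compactSpace.1 hF
  rw [connectedComponentIn_eq_image ha, connectedComponent_eq_iInter_isClopen] at hab
  have hab' : (⟨b, hb⟩ : F) ∉ ⋂ s : { s : Set F // IsClopen s ∧ ⟨a, ha⟩ ∈ s }, (s : Set F) :=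
    fun h => hab ⟨_, h, rfl⟩
  simp only [mem_iInter, not_forall] at hab'
  obtain ⟨⟨s, hs, has⟩, hbs⟩ := hab'
  have h₁ : IsCompact ((↑) '' s : Set X) := hs.isClosed.isCompact.image continuous_subtype_val
  have h₂ : IsCompact ((↑) '' sᶜ : Set X) :=
    hs.compl.isClosed.isCompact.image continuous_subtype_val
  obtain ⟨u, v, hu, hv, hsu, hsv, huv⟩ := SeparatedNhds.of_isCompact_isCompact h₁ h₂
    ((disjoint_image_iff Subtype.val_injective).2 disjoint_compl_right)
  refine ⟨u, v, hu, hv, huv, fun x hx => ?_, hsu ⟨_, has, rfl⟩, hsv ⟨_, hbs, rfl⟩⟩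
  by_cases hxs : (⟨x, hx⟩ : F) ∈ s
  · exact Or.inl (hsu ⟨_, hxs, rfl⟩)
  · exact Or.inr (hsv ⟨_, hxs, rfl⟩)

/-- A real function that never drops immediately to the right of a point, and never drops when a
point is reached from the left, is nondecreasing. -/
lemma le_of_eventually_le_nhdsGT_of_eventually_le_nhdsLT {α : Type*} [LinearOrder α] {g : ℝ → α}
    {a b : ℝ} (hab : a ≤ b) (hR : ∀ s, a ≤ s → ∀ᶠ t in 𝓝[>] s, g s ≤ g t)
    (hL : ∀ s, a < s → ∀ᶠ t in 𝓝[<] s, g t ≤ g s) : g a ≤ g b := by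
  by_contra! hlt
  set S := {t | a ≤ t ∧ g t < g a} with hS
  have hbS : b ∈ S := ⟨hab, hlt⟩
  have hbdd : BddBelow S := ⟨a, fun t ht => ht.1⟩
  set m := sInf S with hm
  have ham : a ≤ m := le_csInf ⟨b, hbS⟩ fun t ht => ht.1
  by_cases hmS : m ∈ S
  · have ham' : a < m := ham.lt_of_ne fun h => by
      have := hmS.2
      rw [← h] at this
      exact lt_irrefl _ this
    obtain ⟨t, ht, hat, htm⟩ := ((hL m ham').and (Ioo_mem_nhdsLT ham')).exists
    exact htm.not_ge (csInf_le hbdd ⟨hat.le, ht.trans_lt hmS.2⟩)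
  · have hgm : g a ≤ g m := not_lt.1 fun h => hmS ⟨ham, h⟩
    obtain ⟨u, hu, hmu⟩ := (mem_nhdsGT_iff_exists_Ioo_subset).1 (hR m ham)
    obtain ⟨t, htS, htu⟩ := exists_lt_of_csInf_lt ⟨b, hbS⟩ hu
    have hmt : m < t := (csInf_le hbdd htS).lt_of_ne fun h => hmS (by rw [hm, h]; exact htS)
    exact (hgm.trans (hmu ⟨hmt, htu⟩)).not_gt htS.2

end Topology

/-- Collapsing each of the sets `T c`, `c ∈ F`, to a point loses at most `∑ c ∈ F, m c` classes if
`T c` has at most `m c + 1` elements. -/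
lemma exists_collapse {α β : Type*} [DecidableEq α] (A : Finset α) (T : β → Finset α)
    (m : β → ℕ) (F : Finset β) (hTA : ∀ c ∈ F, T c ⊆ A) (hT : ∀ c ∈ F, (T c).card ≤ m c + 1) :
    ∃ f : α → α, (∀ c ∈ F, ∀ x ∈ T c, ∀ y ∈ T c, f x = f y) ∧
      A.card ≤ (A.image f).card + ∑ c ∈ F, m c := by
  classical
  induction F using Finset.induction_on with
  | empty => exact ⟨id, by simp, by simp⟩
  | insert c F hc ih =>
    obtain ⟨f, hf, hcard⟩ := ih (fun c hc => hTA c (Finset.mem_insert_of_mem hc))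
      (fun c hc => hT c (Finset.mem_insert_of_mem hc))
    rw [Finset.sum_insert hc]
    obtain hE | ⟨t, ht⟩ := (T c).eq_empty_or_nonempty
    · exact ⟨f, by simpa [hE] using hf, by omega⟩
    set g : α → α := fun y => if y ∈ (T c).image f then f t else y with hg
    have hgT : ∀ x ∈ T c, g (f x) = f t := fun x hx => if_pos (Finset.mem_image_of_mem f hx)
    refine ⟨g ∘ f, ?_, ?_⟩
    · intro d hd x hx y hy
      obtain rfl | hd := Finset.mem_insert.1 hd
      · simp only [Function.comp, hgT x hx, hgT y hy]
      · simp only [Function.comp, hf d hd x hx y hy]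
    · have hsub : A.image f ⊆ A.image (g ∘ f) ∪ ((T c).image f).erase (f t) := by
        intro y hy
        by_cases hyt : y = f t
        · subst hyt
          exact Finset.mem_union_left _ (Finset.mem_image.2
            ⟨t, hTA c (Finset.mem_insert_self _ _) ht, hgT t ht⟩)
        by_cases hyT : y ∈ (T c).image f
        · exact Finset.mem_union_right _ (Finset.mem_erase.2 ⟨hyt, hyT⟩)
        · obtain ⟨x, hx, rfl⟩ := Finset.mem_image.1 hy
          exact Finset.mem_union_left _ (Finset.mem_image.2 ⟨x, hx, if_neg hyT⟩)
      have h₁ := (Finset.card_le_card hsub).trans (Finset.card_union_le _ _)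
      rw [Finset.card_erase_of_mem (Finset.mem_image_of_mem f ht)] at h₁
      have h₂ : ((T c).image f).card ≤ (T c).card := Finset.card_image_le
      have h₃ := hT c (Finset.mem_insert_self _ _)
      omega

/-- An image of a finite set under a map that identifies more points is smaller. -/
lemma Finset.card_image_le_card_image_of_eq_imp_eq {α β γ : Type*} [DecidableEq β]
    [DecidableEq γ] {A : Finset α} {f : α → β} {g : α → γ}
    (h : ∀ a ∈ A, ∀ b ∈ A, g a = g b → f a = f b) : (A.image f).card ≤ (A.image g).card := by
  classical
  obtain rfl | ⟨a₀, -⟩ := A.eq_empty_or_nonempty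
  · simp
  refine Finset.card_le_card_of_surjOn
    (fun y => if hy : ∃ a ∈ A, g a = y then f hy.choose else f a₀) fun y hy => ?_
  obtain ⟨a, ha, rfl⟩ := Finset.mem_image.1 (Finset.mem_coe.1 hy)
  have hex : ∃ b ∈ A, g b = g a := ⟨a, ha, rfl⟩
  refine ⟨g a, by simpa using hex, ?_⟩
  simp only [dif_pos hex]
  exact h _ hex.choose_spec.1 _ ha hex.choose_spec.2

namespace Polynomial

open Set Filter Topology

variable {q : ℂ[X]}

/-- Near a point `c`, a nonconstant polynomial takes the value `q.eval c` only at `c`, and every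
other value at most `q.derivative.rootMultiplicity c + 1` times. -/
lemma exists_nhds_card_fiber_le (hq : 0 < q.natDegree) (c : ℂ) :
    ∃ N ∈ 𝓝 c, (∀ z ∈ N, q.eval z = q.eval c → z = c) ∧
      ∀ (v : ℂ) (T : Finset ℂ), (∀ z ∈ T, z ∈ N ∧ q.eval z = v) →
        T.card ≤ q.derivative.rootMultiplicity c + 1 := by
  classical
  set P : ℂ[X] := q - C (q.eval c) with hP
  have hP0 : P ≠ 0 := by
    rintro h
    rw [hP, sub_eq_zero] at h
    rw [h, natDegree_C] at hq
    exact hq.false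
  have hroot : P.IsRoot c := by simp [hP]
  set e := P.rootMultiplicity c with he
  have he0 : 0 < e := (rootMultiplicity_pos hP0).2 hroot
  have hder : q.derivative.rootMultiplicity c = e - 1 := by
    rw [he, ← derivative_rootMultiplicity_of_root hroot, hP]
    simp
  set h : ℂ[X] := P /ₘ (X - C c) ^ e with hh
  have hc0 : h.eval c ≠ 0 := eval_divByMonic_pow_rootMultiplicity_ne_zero c hP0
  have hfac : ∀ z, q.eval z - q.eval c = (z - c) ^ e * h.eval z := by
    intro z
    have := congrArg (eval z) (pow_mul_divByMonic_rootMultiplicity_eq P c)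
    rw [eval_mul, eval_pow, eval_sub, eval_X, eval_C] at this
    rw [hh, he, this, hP, eval_sub, eval_C]
  set φ : ℂ → ℂ := fun z => (z - c) * (h.eval z / h.eval c) ^ ((e : ℂ)⁻¹) with hφ
  have hφpow : ∀ z, φ z ^ e = (q.eval z - q.eval c) / h.eval c := by
    intro z
    rw [hφ, mul_pow, Complex.cpow_nat_inv_pow _ he0.ne', hfac, mul_div_assoc]
  have hφd : HasStrictDerivAt φ 1 c := by
    have h₁ : HasStrictDerivAt (fun z => z - c) 1 c := (hasStrictDerivAt_id c).sub_const c
    have h₂ : HasStrictDerivAt (fun z => h.eval z / h.eval c)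
        (h.derivative.eval c / h.eval c) c := (h.hasStrictDerivAt c).div_const _
    have h₃ := h₁.mul (h₂.cpow_const (c := (e : ℂ)⁻¹) (by
      rw [div_self hc0]; exact Complex.one_mem_slitPlane))
    exact HasStrictDerivAt.congr_deriv h₃ (by simp [hc0])
  have hφ0 : φ c = 0 := by simp [hφ]
  let Φ := (hφd.hasStrictFDerivAt_equiv one_ne_zero).toOpenPartialHomeomorph φ
  have hinj : InjOn φ Φ.source := Φ.injOn
  have hcs : c ∈ Φ.source :=
    (hφd.hasStrictFDerivAt_equiv one_ne_zero).mem_toOpenPartialHomeomorph_source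
  refine ⟨Φ.source, Φ.open_source.mem_nhds hcs, fun z hz hzc => hinj hz hcs ?_, fun v T hT => ?_⟩
  · rw [hφ0]
    apply eq_zero_of_pow_eq_zero (n := e)
    rw [hφpow, hzc, sub_self, zero_div]
  · rw [hder, Nat.sub_add_cancel he0, ← Finset.card_image_of_injOn
      (f := φ) (s := T) (hinj.mono fun z hz => (hT z hz).1)]
    refine le_trans ?_ (card_nthRoots e ((v - q.eval c) / h.eval c))
    refine le_trans (Finset.card_le_card ?_) (Multiset.toFinset_card_le _)
    intro y hy
    obtain ⟨z, hz, rfl⟩ := Finset.mem_image.1 hy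
    rw [Multiset.mem_toFinset, mem_nthRoots he0, hφpow, (hT z hz).2]

/-- The closed sublevel set `{‖q‖ ≤ s}`. -/
def sublevel (q : ℂ[X]) (s : ℝ) : Set ℂ := {z | ‖q.eval z‖ ≤ s}

/-- The open sublevel set `{‖q‖ < s}`. -/
def strictSublevel (q : ℂ[X]) (s : ℝ) : Set ℂ := {z | ‖q.eval z‖ < s}

open scoped Classical in
/-- The connected components of `K` which contain a root of `q`. -/
noncomputable def rootComponents (q : ℂ[X]) (K : Set ℂ) : Finset (Set ℂ) :=
  q.roots.toFinset.image (connectedComponentIn K)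

open scoped Classical in
/-- The number, with multiplicity, of critical points of `q` in `q.sublevel s`. -/
noncomputable def critCount (q : ℂ[X]) (s : ℝ) : ℕ :=
  (q.derivative.roots.filter fun z => ‖q.eval z‖ ≤ s).card

lemma mem_sublevel {s : ℝ} {z : ℂ} : z ∈ q.sublevel s ↔ ‖q.eval z‖ ≤ s := Iff.rfl

lemma mem_strictSublevel {s : ℝ} {z : ℂ} : z ∈ q.strictSublevel s ↔ ‖q.eval z‖ < s := Iff.rfl

lemma sublevel_mono (q : ℂ[X]) {s t : ℝ} (h : s ≤ t) : q.sublevel s ⊆ q.sublevel t :=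
  fun _ hz => le_trans hz h

lemma strictSublevel_subset_sublevel (q : ℂ[X]) (s : ℝ) : q.strictSublevel s ⊆ q.sublevel s :=
  fun _ hz => mem_sublevel.2 (mem_strictSublevel.1 hz).le

lemma isOpen_strictSublevel (q : ℂ[X]) (s : ℝ) : IsOpen (q.strictSublevel s) :=
  isOpen_lt q.continuous.norm continuous_const

lemma isCompact_sublevel (hq : 0 < q.natDegree) (s : ℝ) : IsCompact (q.sublevel s) := by
  have h := (q.tendsto_norm_atTop (natDegree_pos_iff_degree_pos.1 hq)
    (tendsto_norm_cocompact_atTop (E := ℂ))).eventually_gt_atTop s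
  obtain ⟨K, hK, hKs⟩ := mem_cocompact.1 h
  refine hK.of_isClosed_subset (isClosed_le q.continuous.norm continuous_const) fun z hz => ?_
  by_contra hzK
  exact (hKs hzK).not_ge (mem_sublevel.1 hz)

lemma closure_strictSublevel_subset (q : ℂ[X]) (s : ℝ) :
    closure (q.strictSublevel s) ⊆ q.sublevel s :=
  closure_minimal (q.strictSublevel_subset_sublevel s)
    (isClosed_le q.continuous.norm continuous_const)

lemma mem_rootComponents {K V : Set ℂ} (hq : q ≠ 0) :
    V ∈ q.rootComponents K ↔ ∃ a, q.eval a = 0 ∧ connectedComponentIn K a = V := by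
  simp [rootComponents, hq]

lemma mem_sublevel_of_eval_eq_zero {s : ℝ} (hs : 0 ≤ s) {a : ℂ} (ha : q.eval a = 0) :
    a ∈ q.sublevel s := by
  simpa [sublevel, ha] using hs

lemma mem_strictSublevel_of_eval_eq_zero {s : ℝ} (hs : 0 < s) {a : ℂ} (ha : q.eval a = 0) :
    a ∈ q.strictSublevel s := by
  simpa [strictSublevel, ha] using hs

lemma exists_root_mem_connectedComponentIn_strictSublevel (hq : 0 < q.natDegree) {s : ℝ} {x : ℂ}
    (hx : x ∈ q.strictSublevel s) :
    ∃ a ∈ connectedComponentIn (q.strictSublevel s) x, q.eval a = 0 := by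
  have hs : 0 < s := (norm_nonneg _).trans_lt hx
  refine subset_image_connectedComponentIn (E := Metric.ball 0 s) q.continuous
    (q.isOpenQuotientMap_eval hq.ne').isOpenMap (q.isOpen_strictSublevel s)
    ((isCompact_sublevel hq s).of_isClosed_subset isClosed_closure
      (q.closure_strictSublevel_subset s)) (convex_ball _ _).isPreconnected ?_ ?_ hx
    (Metric.mem_ball_self hs)
  · intro z hz
    simpa [strictSublevel] using hz
  · intro z _ hz
    simpa [strictSublevel] using hz

lemma eventually_notMem_connectedComponentIn_sublevel (hq : 0 < q.natDegree) {s : ℝ} {a b : ℂ}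
    (ha : a ∈ q.sublevel s) (hb : b ∈ q.sublevel s)
    (hab : b ∉ connectedComponentIn (q.sublevel s) a) :
    ∀ᶠ t in 𝓝[>] s, b ∉ connectedComponentIn (q.sublevel t) a := by
  obtain ⟨u, v, hu, hv, huv, hsub, hau, hbv⟩ :=
    (isCompact_sublevel hq s).exists_isOpen_separation_of_notMem_connectedComponentIn ha hb hab
  have key : ∀ᶠ t in 𝓝[>] s, q.sublevel t ⊆ u ∪ v := by
    have hK : IsCompact (q.sublevel (s + 1) \ (u ∪ v)) :=
      (isCompact_sublevel hq _).diff (hu.union hv)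
    obtain hE | hne := (q.sublevel (s + 1) \ (u ∪ v)).eq_empty_or_nonempty
    · filter_upwards [Ioo_mem_nhdsGT (lt_add_one s)] with t ht
      exact (q.sublevel_mono ht.2.le).trans (sdiff_eq_empty.1 hE)
    · obtain ⟨y, hy, hmin⟩ := hK.exists_isMinOn hne q.continuous.norm.continuousOn
      have hsy : s < ‖q.eval y‖ := not_le.1 fun h => hy.2 (hsub h)
      filter_upwards [Ioo_mem_nhdsGT (lt_add_one s), Ioo_mem_nhdsGT hsy] with t ht hty z hz
      by_contra hzuv
      exact ((hmin ⟨q.sublevel_mono ht.2.le hz, hzuv⟩).trans hz).not_gt hty.2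
  filter_upwards [key, self_mem_nhdsWithin] with t ht hst hbt
  have hpre := isPreconnected_connectedComponentIn (F := q.sublevel t) (x := a)
  have := hpre.subset_left_of_subset_union hu hv huv ((connectedComponentIn_subset _ _).trans ht)
    ⟨a, mem_connectedComponentIn (q.sublevel_mono (le_of_lt hst) ha), hau⟩
  exact huv.le_bot ⟨this hbt, hbv⟩

lemma exists_root_mem_connectedComponentIn_sublevel (hq : 0 < q.natDegree) {s : ℝ} {x : ℂ}
    (hx : x ∈ q.sublevel s) :
    ∃ a ∈ connectedComponentIn (q.sublevel s) x, q.eval a = 0 := by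
  by_contra! hno
  have hs : 0 ≤ s := (norm_nonneg _).trans hx
  have hq0 : q ≠ 0 := ne_zero_of_natDegree_gt hq
  have hev : ∀ᶠ t in 𝓝[>] s, ∀ a ∈ q.roots.toFinset,
      a ∉ connectedComponentIn (q.sublevel t) x := by
    rw [Filter.eventually_all_finset]
    intro a ha
    have ha0 : q.eval a = 0 := by simpa [hq0] using ha
    exact eventually_notMem_connectedComponentIn_sublevel hq hx
      (mem_sublevel_of_eval_eq_zero hs ha0) fun h => hno a h ha0
  obtain ⟨t, ht, hst⟩ := (hev.and self_mem_nhdsWithin).exists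
  obtain ⟨a, ha, ha0⟩ := exists_root_mem_connectedComponentIn_strictSublevel hq
    (s := t) (x := x) (lt_of_le_of_lt hx hst)
  exact ht a (by simpa [hq0] using ha0)
    (connectedComponentIn_mono x (q.strictSublevel_subset_sublevel t) ha)

lemma eventually_card_rootComponents_sublevel_le (hq : 0 < q.natDegree) {s : ℝ} (hs : 0 ≤ s) :
    ∀ᶠ t in 𝓝[>] s,
      (q.rootComponents (q.sublevel s)).card ≤ (q.rootComponents (q.sublevel t)).card := by
  have hq0 : q ≠ 0 := ne_zero_of_natDegree_gt hq
  have hev : ∀ᶠ t in 𝓝[>] s, ∀ a ∈ q.roots.toFinset, ∀ b ∈ q.roots.toFinset,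
      connectedComponentIn (q.sublevel t) a = connectedComponentIn (q.sublevel t) b →
      connectedComponentIn (q.sublevel s) a = connectedComponentIn (q.sublevel s) b := by
    simp_rw [Filter.eventually_all_finset]
    intro a ha b hb
    have ha0 : q.eval a = 0 := by simpa [hq0] using ha
    have hb0 : q.eval b = 0 := by simpa [hq0] using hb
    by_cases hab : b ∈ connectedComponentIn (q.sublevel s) a
    · exact Filter.Eventually.of_forall fun t _ => connectedComponentIn_eq hab
    · filter_upwards [eventually_notMem_connectedComponentIn_sublevel hq
        (mem_sublevel_of_eval_eq_zero hs ha0) (mem_sublevel_of_eval_eq_zero hs hb0) hab,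
        self_mem_nhdsWithin] with t ht hst heq
      refine absurd ?_ ht
      rw [heq]
      exact mem_connectedComponentIn (mem_sublevel_of_eval_eq_zero (hs.trans (le_of_lt hst)) hb0)
  filter_upwards [hev] with t ht
  exact Finset.card_image_le_card_image_of_eq_imp_eq ht

lemma eventually_card_rootComponents_le_strictSublevel (hq : 0 < q.natDegree) {s : ℝ}
    (hs : 0 < s) : ∀ᶠ t in 𝓝[<] s,
      (q.rootComponents (q.sublevel t)).card ≤ (q.rootComponents (q.strictSublevel s)).card := by
  have hq0 : q ≠ 0 := ne_zero_of_natDegree_gt hq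
  have hev : ∀ᶠ t in 𝓝[<] s, ∀ a ∈ q.roots.toFinset, ∀ b ∈ q.roots.toFinset,
      connectedComponentIn (q.strictSublevel s) a = connectedComponentIn (q.strictSublevel s) b →
      connectedComponentIn (q.sublevel t) a = connectedComponentIn (q.sublevel t) b := by
    simp_rw [Filter.eventually_all_finset]
    intro a ha b hb
    have ha0 : q.eval a = 0 := by simpa [hq0] using ha
    have hb0 : q.eval b = 0 := by simpa [hq0] using hb
    by_cases hab : connectedComponentIn (q.strictSublevel s) a =
        connectedComponentIn (q.strictSublevel s) b
    · have haU := mem_strictSublevel_of_eval_eq_zero hs ha0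
      have hbW : b ∈ connectedComponentIn (q.strictSublevel s) a :=
        hab ▸ mem_connectedComponentIn (mem_strictSublevel_of_eval_eq_zero hs hb0)
      have hW : IsPathConnected (connectedComponentIn (q.strictSublevel s) a) :=
        (q.isOpen_strictSublevel s).connectedComponentIn.isConnected_iff_isPathConnected.1
          (isConnected_connectedComponentIn_iff.2 haU)
      obtain ⟨γ, hγ⟩ := hW.joinedIn a (mem_connectedComponentIn haU) b hbW
      obtain ⟨y, ⟨θ, rfl⟩, hmax⟩ := (isCompact_range γ.continuous).exists_isMaxOn
        (range_nonempty γ) q.continuous.norm.continuousOn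
      have hlt : ‖q.eval (γ θ)‖ < s :=
        mem_strictSublevel.1 (connectedComponentIn_subset _ _ (hγ θ))
      filter_upwards [Ioo_mem_nhdsLT hlt] with t ht _
      refine connectedComponentIn_eq ?_
      refine (isPreconnected_range γ.continuous).subset_connectedComponentIn ⟨0, γ.source⟩
        (fun z hz => ?_) ⟨1, γ.target⟩
      exact (hmax hz).trans ht.1.le
    · exact Filter.Eventually.of_forall fun t h => absurd h hab
  filter_upwards [hev] with t ht
  exact Finset.card_image_le_card_image_of_eq_imp_eq ht

lemma eq_connectedComponentIn_of_mem_rootComponents {K V : Set ℂ} (hq : q ≠ 0)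
    (hV : V ∈ q.rootComponents K) {x : ℂ} (hx : x ∈ V) : V = connectedComponentIn K x := by
  obtain ⟨a, -, rfl⟩ := (mem_rootComponents hq).1 hV
  exact connectedComponentIn_eq hx

lemma subset_of_mem_rootComponents {K V : Set ℂ} (hq : q ≠ 0)
    (hV : V ∈ q.rootComponents K) : V ⊆ K := by
  obtain ⟨a, -, rfl⟩ := (mem_rootComponents hq).1 hV
  exact connectedComponentIn_subset _ _

open scoped Classical in
lemma card_filter_mem_closure_rootComponents_le (hq : 0 < q.natDegree) {s : ℝ} (hs : 0 < s)
    {c : ℂ} (hc : ‖q.eval c‖ = s) :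
    ((q.rootComponents (q.strictSublevel s)).filter (c ∈ closure ·)).card ≤
      q.derivative.rootMultiplicity c + 1 := by
  have hq0 : q ≠ 0 := ne_zero_of_natDegree_gt hq
  obtain ⟨N, hN, hNc, hNcard⟩ := exists_nhds_card_fiber_le hq c
  obtain ⟨ε, hε, hεN⟩ := Metric.nhds_basis_closedBall.mem_iff.1 hN
  obtain ⟨δ, hδ, hδle⟩ : ∃ δ > 0, ∀ z ∈ Metric.sphere c ε, δ ≤ ‖q.eval z - q.eval c‖ := by
    obtain ⟨y, hy, hmin⟩ := (isCompact_sphere c ε).exists_isMinOn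
      (NormedSpace.sphere_nonempty.2 hε.le)
      (q.continuous.sub (continuous_const (y := q.eval c))).norm.continuousOn
    refine ⟨‖q.eval y - q.eval c‖, norm_pos_iff.2 (sub_ne_zero.2 fun h => ?_),
      fun z hz => hmin hz⟩
    have := hNc y (hεN (Metric.sphere_subset_closedBall hy)) h
    rw [this, mem_sphere_iff_norm, sub_self, norm_zero] at hy
    exact hε.ne hy
  set E : Set ℂ := Metric.ball 0 s ∩ Metric.ball (q.eval c) δ with hE
  have hEpre : IsPreconnected E :=
    ((convex_ball _ _).inter (convex_ball _ _)).isPreconnected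
  obtain ⟨v, hv⟩ : E.Nonempty := by
    have : q.eval c ∈ closure (Metric.ball (0 : ℂ) s) := by
      rw [closure_ball _ hs.ne']
      simpa using hc.le
    rw [hE, inter_comm]
    exact mem_closure_iff.1 this _ Metric.isOpen_ball (Metric.mem_ball_self hδ)
  set G : Set ℂ := Metric.ball c ε ∩ (fun z => q.eval z) ⁻¹' E with hG
  have hGo : IsOpen G := Metric.isOpen_ball.inter
    ((Metric.isOpen_ball.inter Metric.isOpen_ball).preimage q.continuous)
  have hGcl : closure G ⊆ Metric.closedBall c ε :=
    closure_minimal (inter_subset_left.trans Metric.ball_subset_closedBall)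
      Metric.isClosed_closedBall
  have hGU : G ⊆ q.strictSublevel s := fun z hz => by
    simpa [strictSublevel] using hz.2.1
  have hGbd : ∀ z ∈ closure G, q.eval z ∈ E → z ∈ G := by
    intro z hz hzE
    refine ⟨Metric.mem_ball.2 ((Metric.mem_closedBall.1 (hGcl hz)).lt_of_ne fun h => ?_), hzE⟩
    have h₁ := hδle z (Metric.mem_sphere.2 h)
    have h₂ := hzE.2
    rw [Metric.mem_ball, dist_eq_norm] at h₂
    exact h₂.not_ge h₁
  have key : ∀ V, ∃ z, V ∈ (q.rootComponents (q.strictSublevel s)).filter (c ∈ closure ·) →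
      z ∈ V ∧ z ∈ N ∧ q.eval z = v := by
    intro V
    by_cases hV : V ∈ (q.rootComponents (q.strictSublevel s)).filter (c ∈ closure ·)
    swap
    · exact ⟨0, fun h => absurd h hV⟩
    obtain ⟨hV, hcV⟩ := Finset.mem_filter.1 hV
    obtain ⟨x, ⟨hxε, hxδ⟩, hxV⟩ := mem_closure_iff.1 hcV
      (Metric.ball c ε ∩ (fun z => q.eval z) ⁻¹' Metric.ball (q.eval c) δ)
      (Metric.isOpen_ball.inter (Metric.isOpen_ball.preimage q.continuous))
      ⟨Metric.mem_ball_self hε, Metric.mem_ball_self hδ⟩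
    have hxG : x ∈ G := by
      refine ⟨hxε, ?_, hxδ⟩
      simpa [strictSublevel] using subset_of_mem_rootComponents hq0 hV hxV
    obtain ⟨z, hzW, hzv⟩ := subset_image_connectedComponentIn q.continuous
      (q.isOpenQuotientMap_eval hq.ne').isOpenMap hGo
      ((isCompact_closedBall c ε).of_isClosed_subset isClosed_closure hGcl)
      hEpre (fun z hz => hz.2) hGbd hxG hv
    refine ⟨z, fun _ => ⟨?_, ?_, hzv⟩⟩
    · rw [eq_connectedComponentIn_of_mem_rootComponents hq0 hV hxV]
      exact connectedComponentIn_mono x hGU hzW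
    · exact hεN (hGcl (subset_closure (connectedComponentIn_subset _ _ hzW)))
  choose ζ hζ using key
  rw [← Finset.card_image_of_injOn (f := ζ)]
  · refine hNcard v _ fun z hz => ?_
    obtain ⟨V, hV, rfl⟩ := Finset.mem_image.1 hz
    exact (hζ V hV).2
  · intro V hV V' hV' h
    have h₁ := (hζ V hV).1
    have h₂ := (hζ V' hV').1
    rw [← h] at h₂
    rw [eq_connectedComponentIn_of_mem_rootComponents hq0 (Finset.mem_filter.1 hV).1 h₁,
      eq_connectedComponentIn_of_mem_rootComponents hq0 (Finset.mem_filter.1 hV').1 h₂]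

lemma exists_mem_rootComponents_mem_closure (hq : 0 < q.natDegree) {s : ℝ} (hs : 0 < s)
    {x : ℂ} (hx : x ∈ q.sublevel s) :
    ∃ V ∈ q.rootComponents (q.strictSublevel s), x ∈ closure V := by
  have hx' : x ∈ closure (q.strictSublevel s) := by
    have h : q.strictSublevel s = (fun z => q.eval z) ⁻¹' Metric.ball 0 s := by
      ext z
      simp [strictSublevel]
    rw [h, ← (q.isOpenQuotientMap_eval hq.ne').isOpenMap.preimage_closure_eq_closure_preimage
      q.continuous, closure_ball _ hs.ne']
    simpa [sublevel] using hx
  have hsub : q.strictSublevel s ⊆ ⋃ V ∈ q.rootComponents (q.strictSublevel s), V := by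
    intro z hz
    obtain ⟨a, ha, ha0⟩ := exists_root_mem_connectedComponentIn_strictSublevel hq hz
    refine mem_biUnion ((mem_rootComponents (ne_zero_of_natDegree_gt hq)).2 ⟨a, ha0, rfl⟩) ?_
    rw [← connectedComponentIn_eq ha]
    exact mem_connectedComponentIn hz
  have := closure_mono hsub hx'
  rw [Finset.closure_biUnion] at this
  simpa using this

open scoped Classical in
lemma card_rootComponents_strictSublevel_le (hq : 0 < q.natDegree) {s : ℝ} (hs : 0 < s) :
    (q.rootComponents (q.strictSublevel s)).card ≤ (q.rootComponents (q.sublevel s)).card +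
      (q.derivative.roots.filter fun z => ‖q.eval z‖ = s).card := by
  have hq0 : q ≠ 0 := ne_zero_of_natDegree_gt hq
  have hq' : q.derivative ≠ 0 := fun h => hq.ne' (derivative_eq_zero.1 h)
  set 𝒱 := q.rootComponents (q.strictSublevel s) with h𝒱
  set M := q.derivative.roots.filter fun z => ‖q.eval z‖ = s with hM
  have hMmem : ∀ c ∈ M.toFinset, ‖q.eval c‖ = s := fun c hc => by
    rw [hM, Multiset.mem_toFinset, Multiset.mem_filter] at hc
    exact hc.2
  obtain ⟨f, hf, hcard⟩ := exists_collapse 𝒱 (fun c => 𝒱.filter (c ∈ closure ·))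
    (fun c => q.derivative.rootMultiplicity c) M.toFinset (fun c _ => Finset.filter_subset _ _)
    (fun c hc => card_filter_mem_closure_rootComponents_le hq hs (hMmem c hc))
  have hsum : ∑ c ∈ M.toFinset, q.derivative.rootMultiplicity c = M.card := by
    rw [← Multiset.toFinset_sum_count_eq]
    refine Finset.sum_congr rfl fun c hc => ?_
    rw [hM, Multiset.count_filter_of_pos (p := fun z => ‖q.eval z‖ = s) (hMmem c hc), count_roots]
  have key : ∀ V ∈ 𝒱, ∀ V' ∈ 𝒱, ∀ x ∈ closure V, x ∈ closure V' → f V = f V' := by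
    intro V hV V' hV' x hx hx'
    by_cases hVV : V = V'
    · rw [hVV]
    have hxs : ‖q.eval x‖ ≤ s := q.closure_strictSublevel_subset s
      (closure_mono (subset_of_mem_rootComponents hq0 hV) hx)
    obtain hlt | heq := hxs.lt_or_eq
    · have aux : ∀ W ∈ 𝒱, x ∈ closure W → W = connectedComponentIn (q.strictSublevel s) x := by
        intro W hW hxW
        obtain ⟨y, hy, hyW⟩ := mem_closure_iff.1 hxW _
          (q.isOpen_strictSublevel s).connectedComponentIn (mem_connectedComponentIn hlt)
        rw [eq_connectedComponentIn_of_mem_rootComponents hq0 hW hyW, connectedComponentIn_eq hy]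
      exact absurd ((aux V hV hx).trans (aux V' hV' hx').symm) hVV
    · have hVT : V ∈ 𝒱.filter (x ∈ closure ·) := Finset.mem_filter.2 ⟨hV, hx⟩
      have hVT' : V' ∈ 𝒱.filter (x ∈ closure ·) := Finset.mem_filter.2 ⟨hV', hx'⟩
      refine hf x ?_ V hVT V' hVT'
      have h₁ : 1 < (𝒱.filter (x ∈ closure ·)).card :=
        Finset.one_lt_card.2 ⟨V, hVT, V', hVT', hVV⟩
      have h₂ := card_filter_mem_closure_rootComponents_le hq hs heq
      have h₃ : 0 < q.derivative.rootMultiplicity x := by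
        rw [← h𝒱] at h₂
        omega
      rw [Multiset.mem_toFinset, hM, Multiset.mem_filter, mem_roots hq']
      exact ⟨(rootMultiplicity_pos hq').1 h₃, heq⟩
  have himage : (𝒱.image f).card ≤ (q.rootComponents (q.sublevel s)).card := by
    rw [h𝒱, rootComponents, Finset.image_image]
    refine Finset.card_image_le_card_image_of_eq_imp_eq fun a ha b hb hab => ?_
    have ha0 : q.eval a = 0 := by simpa [hq0] using ha
    have hb0 : q.eval b = 0 := by simpa [hq0] using hb
    by_contra hne
    have hA : ∀ (P : Set ℂ → Prop) [DecidablePred P], IsClosed (⋃ V ∈ 𝒱.filter P, closure V) := fun P _ =>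
      (𝒱.filter P).finite_toSet.isClosed_biUnion fun V _ => isClosed_closure
    have hmem : ∀ x, q.eval x = 0 → connectedComponentIn (q.strictSublevel s) x ∈ 𝒱 ∧
        x ∈ closure (connectedComponentIn (q.strictSublevel s) x) := fun x hx =>
      ⟨(mem_rootComponents hq0).2 ⟨x, hx, rfl⟩,
        subset_closure (mem_connectedComponentIn (mem_strictSublevel_of_eval_eq_zero hs hx))⟩
    have hcover : connectedComponentIn (q.sublevel s) a ⊆
        (⋃ V ∈ 𝒱.filter (fun V => f V = f (connectedComponentIn (q.strictSublevel s) a)),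
          closure V) ∪
        ⋃ V ∈ 𝒱.filter (fun V => ¬ f V = f (connectedComponentIn (q.strictSublevel s) a)),
          closure V := by
      intro x hx
      obtain ⟨V, hV, hxV⟩ := exists_mem_rootComponents_mem_closure hq hs
        (connectedComponentIn_subset _ _ hx)
      by_cases h : f V = f (connectedComponentIn (q.strictSublevel s) a)
      · exact Or.inl (mem_biUnion (Finset.mem_filter.2 ⟨hV, h⟩) hxV)
      · exact Or.inr (mem_biUnion (Finset.mem_filter.2 ⟨hV, h⟩) hxV)
    obtain ⟨x, -, hx₁, hx₂⟩ := isPreconnected_closed_iff.1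
      isPreconnected_connectedComponentIn _ _ (hA _) (hA _) hcover
      ⟨a, mem_connectedComponentIn (mem_sublevel_of_eval_eq_zero hs.le ha0),
        mem_biUnion (Finset.mem_filter.2 ⟨(hmem a ha0).1, rfl⟩) (hmem a ha0).2⟩
      ⟨b, hab ▸ mem_connectedComponentIn (mem_sublevel_of_eval_eq_zero hs.le hb0),
        mem_biUnion (Finset.mem_filter.2 ⟨(hmem b hb0).1, fun h => hne h.symm⟩) (hmem b hb0).2⟩
    obtain ⟨V, hV, hxV⟩ := mem_iUnion₂.1 hx₁
    obtain ⟨V', hV', hxV'⟩ := mem_iUnion₂.1 hx₂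
    rw [Finset.mem_filter] at hV hV'
    exact hV'.2 ((key V hV.1 V' hV'.1 x hxV hxV').symm.trans hV.2)
  omega

lemma critCount_mono (q : ℂ[X]) {s t : ℝ} (h : s ≤ t) : q.critCount s ≤ q.critCount t :=
  Multiset.card_le_card (Multiset.monotone_filter_right _ fun _ hz => hz.trans h)

open scoped Classical in
lemma critCount_add_card_le (q : ℂ[X]) {s t : ℝ} (h : t < s) :
    q.critCount t + (q.derivative.roots.filter fun z => ‖q.eval z‖ = s).card ≤ q.critCount s := by
  have hdis : q.derivative.roots.filter (fun z => ‖q.eval z‖ ≤ t ∧ ‖q.eval z‖ = s) = 0 :=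
    Multiset.filter_eq_nil.2 fun z _ hz => (hz.1.trans_lt h).ne hz.2
  rw [critCount, ← Multiset.card_add, Multiset.filter_add_filter, hdis, add_zero]
  exact Multiset.card_le_card
    (Multiset.monotone_filter_right _ fun _ hz => hz.elim (fun hz => hz.trans h.le) le_of_eq)

lemma card_rootComponents_add_critCount_mono (hq : 0 < q.natDegree) {a b : ℝ} (ha : 0 ≤ a)
    (hab : a ≤ b) :
    (q.rootComponents (q.sublevel a)).card + q.critCount a ≤
      (q.rootComponents (q.sublevel b)).card + q.critCount b := by
  refine le_of_eventually_le_nhdsGT_of_eventually_le_nhdsLT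
    (g := fun s => (q.rootComponents (q.sublevel s)).card + q.critCount s) hab
    (fun s hs => ?_) fun s hs => ?_
  · filter_upwards [eventually_card_rootComponents_sublevel_le hq (ha.trans hs),
      self_mem_nhdsWithin] with t ht hst
    exact add_le_add ht (q.critCount_mono (le_of_lt hst))
  · have hs0 := ha.trans_lt hs
    filter_upwards [eventually_card_rootComponents_le_strictSublevel hq hs0,
      self_mem_nhdsWithin] with t ht hts
    have h₁ := card_rootComponents_strictSublevel_le hq hs0
    have h₂ := q.critCount_add_card_le hts
    omega

lemma natDegree_le_card_rootComponents_zero_add_critCount (hq : 0 < q.natDegree) :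
    q.natDegree ≤ (q.rootComponents (q.sublevel 0)).card + q.critCount 0 := by
  classical
  have hq0 : q ≠ 0 := ne_zero_of_natDegree_gt hq
  have hsub : q.sublevel 0 = q.roots.toFinset := by
    ext z
    simp [sublevel, hq0]
  have h₁ : (q.rootComponents (q.sublevel 0)).card = q.roots.toFinset.card := by
    refine Finset.card_image_of_injOn fun a ha b hb hab => ?_
    have hss : (connectedComponentIn (q.sublevel 0) a).Subsingleton :=
      (hsub ▸ q.roots.toFinset.countable_toSet.isTotallyDisconnected) _
        (connectedComponentIn_subset _ _) isPreconnected_connectedComponentIn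
    refine hss (mem_connectedComponentIn (hsub ▸ ha)) ?_
    rw [hab]
    exact mem_connectedComponentIn (hsub ▸ hb)
  have h₂ : ∑ a ∈ q.roots.toFinset, (q.rootMultiplicity a - 1) ≤ q.critCount 0 := by
    rw [critCount, ← Multiset.toFinset_sum_count_eq]
    calc ∑ a ∈ q.roots.toFinset, (q.rootMultiplicity a - 1)
        = ∑ a ∈ q.roots.toFinset,
            (q.derivative.roots.filter fun z => ‖q.eval z‖ ≤ 0).count a := by
          refine Finset.sum_congr rfl fun a ha => ?_
          have ha0 : q.IsRoot a := by simpa [hq0] using ha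
          rw [Multiset.count_filter_of_pos (p := fun z => ‖q.eval z‖ ≤ 0)
            (norm_le_zero_iff.2 ha0), count_roots, derivative_rootMultiplicity_of_root ha0]
      _ ≤ _ := Finset.sum_le_sum_of_ne_zero fun a _ ha =>
          Multiset.mem_toFinset.2 (Multiset.count_ne_zero.1 ha)
  have h₃ : q.natDegree = ∑ a ∈ q.roots.toFinset, q.rootMultiplicity a := by
    rw [← (IsAlgClosed.splits q).natDegree_eq_card_roots.symm, ← Multiset.toFinset_sum_count_eq]
    simp_rw [count_roots]
  have h₄ : ∑ a ∈ q.roots.toFinset, q.rootMultiplicity a ≤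
      ∑ a ∈ q.roots.toFinset, (1 + (q.rootMultiplicity a - 1)) :=
    Finset.sum_le_sum fun a _ => by omega
  rw [Finset.sum_add_distrib, Finset.sum_const, smul_eq_mul, mul_one] at h₄
  omega

lemma exists_card_rootComponents_add_critCount_le_natDegree (hq : 0 < q.natDegree) (r : ℝ) :
    ∃ t, r ≤ t ∧ (q.rootComponents (q.sublevel t)).card + q.critCount t ≤ q.natDegree := by
  have hq0 : q ≠ 0 := ne_zero_of_natDegree_gt hq
  obtain ⟨R, hR⟩ := q.roots.toFinset.finite_toSet.isBounded.subset_closedBall (0 : ℂ)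
  obtain ⟨B, hB⟩ := (isCompact_closedBall (0 : ℂ) R).exists_bound_of_continuousOn
    q.continuous.continuousOn
  refine ⟨max r B, le_max_left _ _, ?_⟩
  have hball : Metric.closedBall 0 R ⊆ q.sublevel (max r B) :=
    fun z hz => (hB z hz).trans (le_max_right _ _)
  have hroot : ∀ a, q.eval a = 0 → a ∈ Metric.closedBall 0 R := fun a ha =>
    hR (by simpa [hq0] using ha)
  have h₁ : (q.rootComponents (q.sublevel (max r B))).card ≤ 1 := by
    refine Finset.card_le_one.2 fun V hV V' hV' => ?_
    obtain ⟨a, ha, rfl⟩ := (mem_rootComponents hq0).1 hV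
    obtain ⟨b, hb, rfl⟩ := (mem_rootComponents hq0).1 hV'
    exact connectedComponentIn_eq ((convex_closedBall _ _).isPreconnected.subset_connectedComponentIn
      (hroot a ha) hball (hroot b hb))
  have h₂ : q.critCount (max r B) ≤ q.derivative.natDegree :=
    (Multiset.card_le_card (Multiset.filter_le _ _)).trans (card_roots' _)
  have h₃ := natDegree_derivative_lt hq.ne'
  omega

lemma card_rootComponents_add_critCount (hq : 0 < q.natDegree) {r : ℝ} (hr : 0 ≤ r) :
    (q.rootComponents (q.sublevel r)).card + q.critCount r = q.natDegree := by
  obtain ⟨t, hrt, ht⟩ := exists_card_rootComponents_add_critCount_le_natDegree hq r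
  exact ((card_rootComponents_add_critCount_mono hq hr hrt).trans ht).antisymm
    ((natDegree_le_card_rootComponents_zero_add_critCount hq).trans
      (card_rootComponents_add_critCount_mono hq le_rfl hr))

lemma natCard_connectedComponents_sublevel (hq : 0 < q.natDegree) {r : ℝ} (hr : 0 ≤ r) :
    Nat.card (ConnectedComponents (q.sublevel r)) = (q.rootComponents (q.sublevel r)).card := by
  have hq0 : q ≠ 0 := ne_zero_of_natDegree_gt hq
  let Φ : ConnectedComponents (q.sublevel r) → Set ℂ :=
    fun x => (↑) '' ((↑) ⁻¹' {x} : Set (q.sublevel r))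
  have hΦ : ∀ x : q.sublevel r, Φ x = connectedComponentIn (q.sublevel r) x := fun x => by
    rw [connectedComponentIn_eq_image x.2]
    exact congrArg (image Subtype.val) connectedComponents_preimage_singleton
  have hinj : Function.Injective Φ := fun x y hxy => singleton_injective
    (ConnectedComponents.surjective_coe.preimage_injective
      (Subtype.val_injective.image_injective hxy))
  have hrange : range Φ = q.rootComponents (q.sublevel r) := by
    ext V
    rw [Finset.mem_coe, mem_rootComponents hq0]
    constructor
    · rintro ⟨x, rfl⟩
      obtain ⟨x, rfl⟩ := ConnectedComponents.surjective_coe x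
      obtain ⟨a, ha, ha0⟩ := exists_root_mem_connectedComponentIn_sublevel hq x.2
      exact ⟨a, ha0, by rw [hΦ, connectedComponentIn_eq ha]⟩
    · rintro ⟨a, ha0, rfl⟩
      exact ⟨(⟨a, mem_sublevel_of_eval_eq_zero hr ha0⟩ : q.sublevel r), hΦ _⟩
  rw [Nat.card_congr (Equiv.ofInjective Φ hinj), hrange, Nat.card_coe_set_eq,
    ncard_coe_finset]

end Polynomial

open scoped Classical in
/-- If the circle of radius `r` about `w` contains no critical value of `p`, then the
preimage of the closed disk `closedBall w r` under `z ↦ p.eval z` has exactly `d - n_w`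
connected components, where `d` is the degree of `p` and `n_w` is the total multiplicity
of the critical points of `p` whose critical values lie in the closed disk. -/
theorem stmt_18 (p : ℂ[X]) (hp : p ≠ 0) (hd : 1 ≤ p.natDegree)
    (w : ℂ) (r : ℝ) (hr : 0 ≤ r)
    (hreg : ∀ z : ℂ, p.derivative.IsRoot z → p.eval z ∉ Metric.sphere w r) :
    Nat.card (ConnectedComponents
        ((fun z : ℂ => p.eval z) ⁻¹' Metric.closedBall w r)) =
      p.natDegree -
        Multiset.card ((p.derivative.roots).filter
          (fun z => p.eval z ∈ Metric.closedBall w r)) := by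
  set q : ℂ[X] := p - C w with hq
  have hdeg : q.natDegree = p.natDegree := natDegree_sub_C
  have hpos : 0 < q.natDegree := by omega
  have heval : ∀ z, q.eval z = p.eval z - w := fun z => by rw [hq, eval_sub, eval_C]
  have hder : q.derivative = p.derivative := by rw [hq, derivative_sub, derivative_C, sub_zero]
  have hset : (fun z : ℂ => p.eval z) ⁻¹' Metric.closedBall w r = q.sublevel r := by
    ext z
    rw [Set.mem_preimage, mem_closedBall_iff_norm, mem_sublevel, heval]
  have hcrit : Multiset.card (p.derivative.roots.filter
      (fun z => p.eval z ∈ Metric.closedBall w r)) = q.critCount r := by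
    simp only [critCount, hder, heval, mem_closedBall_iff_norm]
  rw [hset, hcrit, natCard_connectedComponents_sublevel hpos hr, ← hdeg,
    ← card_rootComponents_add_critCount hpos hr, Nat.add_sub_cancel]
end

section
/- Let k ≥ 1, let m : Fin k → ℕ with m j ≥ 1 for all j, set n := ∑ j, m j and d := n + 1, and fix b, c ∈ ℂ. For z : Fin k → ℂ let q_z ∈ ℂ[X] be the unique polynomial with derivative (q_z).derivative = (d : ℂ) • ∏ j, (X − C (z j))^(m j) and with q_z.eval b = c (the monic degree-d polynomial with critical points z j of multiplicity m j sending b to c). Define θ : (Fin k → ℂ) → (Fin k → ℂ) by θ z j = q_z.eval (z j), and the Jacobian matrix J z : Matrix (Fin k) (Fin k) ℂ by (J z) i j = deriv (fun w : ℂ => (q_{Function.update z i w}).eval ((Function.update z i w) j)) (z i). Then for every z : Fin k → ℂ: (Nat.multinomial Finset.univ m : ℂ) · Matrix.det (J z) = (d : ℂ)^k · (∏ j, (b − z j)^(m j)) · (∏ over pairs i ≠ j, (z i − z j)^(m j)). In particular J z is invertible if and only if the z j are pairwise distinct and all different from b. -/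
open Polynomial

/-- The linear functional sending a polynomial to its integral from `b` to `x`. -/
noncomputable def integralTo (b x : ℂ) : ℂ[X] →ₗ[ℂ] ℂ :=
  (Polynomial.basisMonomials ℂ).constr ℂ
    (fun n : ℕ => (x ^ (n + 1) - b ^ (n + 1)) / ((n : ℂ) + 1))

lemma integralTo_monomial (b x a : ℂ) (n : ℕ) :
    integralTo b x (monomial n a) = a * ((x ^ (n + 1) - b ^ (n + 1)) / ((n : ℂ) + 1)) := by
  have h : monomial n a = a • Polynomial.basisMonomials ℂ n := by
    simp [Polynomial.coe_basisMonomials, smul_monomial]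
  rw [h, map_smul, integralTo, Module.Basis.constr_basis, smul_eq_mul]

lemma integralTo_derivative (b x : ℂ) (p : ℂ[X]) :
    integralTo b x (derivative p) = p.eval x - p.eval b := by
  induction p using Polynomial.induction_on' with
  | add p q hp hq => rw [derivative_add, map_add, hp, hq, eval_add, eval_add]; ring
  | monomial n a =>
    rw [derivative_monomial, integralTo_monomial, eval_monomial, eval_monomial]
    cases n with
    | zero => simp
    | succ n =>
      have : (n : ℂ) + 1 ≠ 0 := Nat.cast_add_one_ne_zero n
      push_cast
      field_simp

lemma hasDerivAt_integralTo (b : ℂ) (p : ℂ[X]) (x : ℂ) :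
    HasDerivAt (fun w => integralTo b w p) (p.eval x) x := by
  induction p using Polynomial.induction_on' with
  | add p q hp hq => simpa only [map_add, eval_add] using! hp.add hq
  | monomial n a =>
    simp only [integralTo_monomial, eval_monomial]
    have h : (n : ℂ) + 1 ≠ 0 := Nat.cast_add_one_ne_zero n
    have := ((((hasDerivAt_pow (n + 1) x).sub_const (b ^ (n + 1))).div_const
      ((n : ℂ) + 1)).const_mul a)
    convert! this using 1
    push_cast
    field_simp

/-- Leibniz rule for a polynomial integrand depending polynomially on a parameter. -/
lemma hasDerivAt_integralTo_eval (b : ℂ) (T : ℂ[X][X]) (g : ℂ → ℂ) (g' w : ℂ)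
    (hg : HasDerivAt g g' w) :
    HasDerivAt (fun v => integralTo b (g v) (T.eval (C v)))
      (integralTo b (g w) ((derivative T).eval (C w)) + (T.eval (C w)).eval (g w) * g') w := by
  induction T using Polynomial.induction_on' with
  | add p q hp hq =>
    simp only [eval_add, map_add]
    convert! hp.add hq using 1
    ring
  | monomial n p =>
    have key : ∀ (v : ℂ) (r : ℂ[X]) (n : ℕ) (u : ℂ),
        integralTo b u (r * (C v) ^ n) = v ^ n * integralTo b u r := by
      intro v r n u
      rw [← C_pow, mul_comm, ← smul_eq_C_mul, map_smul, smul_eq_mul]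
    simp only [eval_monomial, derivative_monomial, key]
    convert! (hasDerivAt_pow n w).mul ((hasDerivAt_integralTo b p (g w)).comp w hg) using 1
    have : p * (n : ℂ[X]) = (n : ℂ) • p := by
      rw [smul_eq_C_mul, mul_comm]; simp
    rw [this, map_smul]
    simp
    ring

lemma integralTo_X_sub_C_pow (b x : ℂ) (n : ℕ) :
    integralTo b x ((X - C b) ^ n) = (x - b) ^ (n + 1) / ((n : ℂ) + 1) := by
  have h : (n : ℂ) + 1 ≠ 0 := Nat.cast_add_one_ne_zero n
  have h2 : derivative ((X - C b) ^ (n + 1)) = ((n : ℂ) + 1) • (X - C b) ^ n := by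
    rw [derivative_X_sub_C_pow, smul_eq_C_mul]; simp
  have h3 := integralTo_derivative b x ((X - C b) ^ (n + 1))
  rw [h2, map_smul] at h3
  rw [eq_div_iff h, mul_comm]
  simpa using h3

section Cofactor

variable {k : ℕ}

/-- The product of the linear factors `X - z l` over all `l ≠ i`. -/
noncomputable def cofactorPoly (z : Fin k → ℂ) (i : Fin k) : ℂ[X] :=
  ∏ l ∈ Finset.univ.erase i, (X - C (z l))

lemma cofactorPoly_eval (z : Fin k → ℂ) (i j : Fin k) :
    (cofactorPoly z i).eval (z j) =
      if i = j then ∏ l ∈ Finset.univ.erase i, (z i - z l) else 0 := by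
  rw [cofactorPoly, eval_prod]
  split_ifs with h
  · subst h; simp
  · exact Finset.prod_eq_zero (i := j) (by simp [Ne.symm h]) (by simp)

lemma cofactorPoly_mul (z : Fin k → ℂ) (i : Fin k) :
    (X - C (z i)) * cofactorPoly z i = ∏ l, (X - C (z l)) :=
  Finset.mul_prod_erase _ (fun l => X - C (z l)) (Finset.mem_univ i)

lemma natDegree_cofactorPoly_lt (z : Fin k → ℂ) (i : Fin k) :
    (cofactorPoly z i).natDegree < k := by
  rw [cofactorPoly, natDegree_prod_of_monic _ _ (fun l _ => monic_X_sub_C (z l))]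
  have := i.pos
  simp
  omega

lemma cofactorPoly_eq_sum (b : ℂ) (z : Fin k → ℂ) (i : Fin k) :
    cofactorPoly z i =
      ∑ r : Fin k, (taylor b (cofactorPoly z i)).coeff r • (X - C b) ^ (r : ℕ) := by
  conv_lhs => rw [← sum_taylor_eq (cofactorPoly z i) b]
  rw [Polynomial.sum_over_range' _ (by simp) k
    (by rw [natDegree_taylor]; exact natDegree_cofactorPoly_lt z i),
    ← Fin.sum_univ_eq_sum_range
      (fun r => C ((taylor b (cofactorPoly z i)).coeff r) * (X - C b) ^ r)]
  simp only [smul_eq_C_mul]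

/-- The matrix of integrals from `b` to `z j` of `∏ l, (X - z l) ^ μ l` times the cofactors. -/
noncomputable def periodMatrix (b : ℂ) (z : Fin k → ℂ) (μ : Fin k → ℕ) :
    Matrix (Fin k) (Fin k) ℂ :=
  Matrix.of fun i j => integralTo b (z j) ((∏ l, (X - C (z l)) ^ μ l) * cofactorPoly z i)

lemma det_periodMatrix_zero (b : ℂ) (z : Fin k → ℂ) :
    (k.factorial : ℂ) * (periodMatrix b z 0).det =
      (∏ j, (z j - b)) * ∏ i, ∏ j ∈ Finset.univ.erase i, (z i - z j) := by
  set A : Matrix (Fin k) (Fin k) ℂ :=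
    Matrix.of fun i r => (taylor b (cofactorPoly z i)).coeff r with hA
  set V : Matrix (Fin k) (Fin k) ℂ := (Matrix.vandermonde fun j => z j - b).transpose with hV
  have h1 : A * V = Matrix.diagonal fun i => ∏ j ∈ Finset.univ.erase i, (z i - z j) := by
    ext i j
    have := congrArg (eval (z j)) (cofactorPoly_eq_sum b z i)
    rw [cofactorPoly_eval, eval_finsetSum] at this
    rw [Matrix.diagonal_apply, this, Matrix.mul_apply]
    simp [hA, hV, Matrix.vandermonde_apply]
  have h2 : periodMatrix b z 0 = A * (Matrix.diagonal fun r : Fin k => (((r : ℕ) : ℂ) + 1)⁻¹) *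
      V * Matrix.diagonal fun j => z j - b := by
    ext i j
    rw [Matrix.mul_diagonal, Matrix.mul_apply, periodMatrix, Matrix.of_apply,
      cofactorPoly_eq_sum b z i]
    simp only [Pi.zero_apply, pow_zero, Finset.prod_const_one, one_mul, map_sum, map_smul,
      integralTo_X_sub_C_pow, Matrix.mul_diagonal, Finset.sum_mul]
    refine Finset.sum_congr rfl fun r _ => ?_
    simp [hA, hV, Matrix.vandermonde_apply]
    ring
  have h3 : (k.factorial : ℂ) * ∏ r : Fin k, (((r : ℕ) : ℂ) + 1)⁻¹ = 1 := by
    rw [Finset.prod_inv_distrib, Fin.prod_univ_eq_prod_range (fun r : ℕ => (r : ℂ) + 1),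
      ← Finset.prod_range_add_one_eq_factorial]
    push_cast
    refine mul_inv_cancel₀ (Finset.prod_ne_zero_iff.mpr fun r _ => Nat.cast_add_one_ne_zero r)
  have h4 := congrArg Matrix.det h1
  rw [Matrix.det_mul, Matrix.det_diagonal] at h4
  rw [h2, Matrix.det_mul, Matrix.det_mul, Matrix.det_mul, Matrix.det_diagonal,
    Matrix.det_diagonal, ← h4]
  linear_combination (A.det * V.det * ∏ j, (z j - b)) * h3

lemma det_diagonal_add_const_rows (v u : Fin k → ℂ) (l : Fin k) (hl : v l = 0) :
    (Matrix.of fun i j => (if i = j then v i else 0) + u j).det =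
      u l * ∏ i ∈ Finset.univ.erase l, v i := by
  have h : (Matrix.of fun i j => (if i = j then v i else 0) + u j).det =
      ((Matrix.diagonal v).updateRow l u).det := by
    refine Matrix.det_eq_of_forall_row_eq_smul_add_const (fun i => if i = l then 0 else 1) l
      (by simp) fun i j => ?_
    by_cases hi : i = l
    · subst hi; simp [hl]
    · simp [hi, Matrix.diagonal_apply, Matrix.updateRow_ne]
  rw [h, ← Matrix.cramer_transpose_apply, Matrix.cramer_eq_adjugate_mulVec,
    Matrix.diagonal_transpose, Matrix.adjugate_diagonal, Matrix.mulVec_diagonal, mul_comm]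

lemma periodMatrix_integrand_step (b : ℂ) (z : Fin k → ℂ) (μ : Fin k → ℕ) (l i : Fin k) :
    ((∑ j, (μ j + 1) : ℕ) + 1 : ℂ) •
        ((∏ j, (X - C (z j)) ^ μ j) * (X - C (z l)) * cofactorPoly z i) =
      derivative ((X - C b) * ∏ j, (X - C (z j)) ^ (μ j + 1)) +
      ∑ j, ((∑ j, (μ j + 1) : ℕ) + 1 : ℂ) • ((if i = j then z i - z l else 0) +
        ((μ j : ℂ) + 1) * (b - z j) / ((∑ j, (μ j + 1) : ℕ) + 1 : ℂ)) •
          ((∏ j, (X - C (z j)) ^ μ j) * cofactorPoly z j) := by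
  set P : ℂ[X] := ∏ j, (X - C (z j)) ^ μ j with hP
  set d : ℂ := ((∑ j, (μ j + 1) : ℕ) + 1 : ℂ) with hd
  set w : ℂ[X] := ∏ j, (X - C (z j)) with hw
  have hd0 : d ≠ 0 := Nat.cast_add_one_ne_zero _
  have hdc : C d = 1 + ∑ j, C ((μ j : ℂ) + 1) := by
    rw [hd, ← map_sum]; push_cast; simp [add_comm]
  have h1 : ∏ j, (X - C (z j)) ^ (μ j + 1) = P * w := by
    simp only [pow_succ, Finset.prod_mul_distrib, hP, hw]
  have h2 : derivative (∏ j, (X - C (z j)) ^ (μ j + 1)) =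
      ∑ j, C ((μ j : ℂ) + 1) * (P * cofactorPoly z j) := by
    rw [derivative_prod_finset]
    refine Finset.sum_congr rfl fun j _ => ?_
    rw [derivative_X_sub_C_pow, hP, ← Finset.prod_erase_mul _ _ (Finset.mem_univ j), cofactorPoly]
    simp only [pow_succ, Finset.prod_mul_distrib]
    simp
    ring
  rw [derivative_mul, h2, h1]
  have h3 : ∀ j, d • ((if i = j then z i - z l else 0) + ((μ j : ℂ) + 1) * (b - z j) / d) •
      (P * cofactorPoly z j) = (if i = j then C (d * (z i - z l)) * (P * cofactorPoly z i) else 0) +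
        C ((μ j : ℂ) + 1) * (P * w - (X - C b) * (P * cofactorPoly z j)) := by
    intro j
    rw [hw, ← cofactorPoly_mul z j, smul_smul, smul_eq_C_mul, mul_add, mul_div_cancel₀ _ hd0]
    split_ifs with h
    · subst h
      simp only [C_add, C_mul, C_sub]; ring
    · simp only [C_add, C_mul, C_sub, mul_zero, C_0]; ring
  rw [Finset.sum_congr rfl fun j _ => h3 j]
  simp only [Finset.sum_add_distrib, mul_sub, Finset.sum_sub_distrib, Finset.sum_ite_eq,
    Finset.mem_univ, if_true]
  rw [← Finset.sum_mul, smul_eq_C_mul]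
  have h4 : ∑ j, C ((μ j : ℂ) + 1) * ((X - C b) * (P * cofactorPoly z j)) =
      (X - C b) * ∑ j, C ((μ j : ℂ) + 1) * (P * cofactorPoly z j) := by
    rw [Finset.mul_sum]; exact Finset.sum_congr rfl fun j _ => by ring
  have h5 := cofactorPoly_mul z i
  rw [← hw] at h5
  rw [h4]
  simp only [C_mul, C_sub, derivative_sub, derivative_X, derivative_C]
  linear_combination (C d * P) * h5 + P * w * hdc

lemma det_periodMatrix_add_single (b : ℂ) (z : Fin k → ℂ) (μ : Fin k → ℕ) (l : Fin k) :
    ((∑ j, (μ j + 1) : ℕ) + 1 : ℂ) * (periodMatrix b z (μ + Pi.single l 1)).det =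
      ((μ l : ℂ) + 1) * (b - z l) * (∏ i ∈ Finset.univ.erase l, (z i - z l)) *
        (periodMatrix b z μ).det := by
  set d : ℂ := ((∑ j, (μ j + 1) : ℕ) + 1 : ℂ) with hd
  have hd0 : d ≠ 0 := Nat.cast_add_one_ne_zero _
  have h1 : periodMatrix b z (μ + Pi.single l 1) =
      (Matrix.of fun i j => (if i = j then z i - z l else 0) +
        ((μ j : ℂ) + 1) * (b - z j) / d) * periodMatrix b z μ := by
    ext i j
    have hP : ∏ j, (X - C (z j)) ^ ((μ + Pi.single l 1 : Fin k → ℕ) j) =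
        (∏ j, (X - C (z j)) ^ μ j) * (X - C (z l)) := by
      simp only [Pi.add_apply, pow_add, Finset.prod_mul_distrib]
      simp [Pi.single_apply, pow_ite]
    have h := congrArg (integralTo b (z j)) (periodMatrix_integrand_step b z μ l i)
    rw [map_smul, map_add, integralTo_derivative, map_sum] at h
    simp only [map_smul, ← hd] at h
    rw [← Finset.smul_sum] at h
    have h0 : ((X - C b) * ∏ j, (X - C (z j)) ^ (μ j + 1)).eval (z j) = 0 := by
      rw [eval_mul, eval_prod, Finset.prod_eq_zero (Finset.mem_univ j) (by simp), mul_zero]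
    have h0' : ((X - C b) * ∏ j, (X - C (z j)) ^ (μ j + 1)).eval b = 0 := by simp
    rw [h0, h0', sub_zero, zero_add] at h
    rw [Matrix.mul_apply]
    simp only [periodMatrix, Matrix.of_apply, hP]
    exact smul_right_injective ℂ hd0 h
  rw [h1, Matrix.det_mul, det_diagonal_add_const_rows (fun i => z i - z l)
    (fun j => ((μ j : ℂ) + 1) * (b - z j) / d) l (by simp)]
  field_simp

lemma det_periodMatrix (b : ℂ) (z : Fin k → ℂ) (μ : Fin k → ℕ) :
    (-1) ^ k * ((∑ j, (μ j + 1)).factorial : ℂ) * (periodMatrix b z μ).det =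
      (∏ j, ((μ j).factorial : ℂ)) * (∏ j, (b - z j) ^ (μ j + 1)) *
        ∏ i, ∏ j ∈ Finset.univ.erase i, (z i - z j) ^ (μ j + 1) := by
  induction hs : ∑ j, μ j generalizing μ with
  | zero =>
    obtain rfl : μ = 0 := by
      funext j
      exact Finset.sum_eq_zero_iff.mp hs j (Finset.mem_univ j)
    have h := det_periodMatrix_zero b z
    have h2 : ∏ j, (b - z j) = (-1) ^ k * ∏ j, (z j - b) := by
      rw [← Fin.prod_const, ← Finset.prod_mul_distrib]
      exact Finset.prod_congr rfl fun j _ => by ring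
    simp only [Pi.zero_apply, zero_add, pow_one, Nat.factorial_zero, Nat.cast_one,
      Finset.prod_const_one, one_mul, Finset.sum_const, Finset.card_univ, Fintype.card_fin,
      smul_eq_mul, mul_one, h2]
    linear_combination (-1) ^ k * h
  | succ s ih =>
    obtain ⟨l, -, hl⟩ : ∃ l ∈ Finset.univ, μ l ≠ 0 := by
      by_contra! h
      rw [Finset.sum_eq_zero h] at hs
      omega
    obtain ⟨ν, rfl⟩ : ∃ ν : Fin k → ℕ, μ = ν + Pi.single l 1 := by
      refine ⟨μ - Pi.single l 1, ?_⟩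
      funext j
      rcases eq_or_ne j l with rfl | h
      · simp; omega
      · simp [h]
    have hsum : ∀ a : ℕ, ∑ j, ((ν + Pi.single l 1 : Fin k → ℕ) j + a) = (∑ j, (ν j + a)) + 1 := by
      intro a
      simp only [Pi.add_apply, add_right_comm _ _ a, Finset.sum_add_distrib]
      simp
    have hν := ih ν (by have := hsum 0; simp only [add_zero] at this; omega)
    have hstep := det_periodMatrix_add_single b z ν l
    have hpow : ∀ (f : Fin k → ℂ) (s : Finset (Fin k)),
        ∏ j ∈ s, f j ^ ((Pi.single l 1 : Fin k → ℕ) j) = if l ∈ s then f l else 1 := by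
      intro f s
      simp [Pi.single_apply, pow_ite]
    have hfac : ∏ j, (((ν + Pi.single l 1 : Fin k → ℕ) j).factorial : ℂ) =
        (∏ j, ((ν j).factorial : ℂ)) * ((ν l : ℂ) + 1) := by
      have : ∀ j, (((ν + Pi.single l 1 : Fin k → ℕ) j).factorial : ℂ) =
          ((ν j).factorial : ℂ) * ((ν j : ℂ) + 1) ^ ((Pi.single l 1 : Fin k → ℕ) j) := by
        intro j
        rcases eq_or_ne j l with rfl | h
        · simp [Nat.factorial_succ, mul_comm]
        · simp [h]
      simp only [this, Finset.prod_mul_distrib, hpow, Finset.mem_univ, if_true]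
    have hb : ∏ j, (b - z j) ^ ((ν + Pi.single l 1 : Fin k → ℕ) j + 1) =
        (∏ j, (b - z j) ^ (ν j + 1)) * (b - z l) := by
      simp only [Pi.add_apply, add_right_comm _ _ 1, pow_add _ (ν _ + 1),
        Finset.prod_mul_distrib, hpow, Finset.mem_univ, if_true]
    have hz : ∏ i, ∏ j ∈ Finset.univ.erase i,
          (z i - z j) ^ ((ν + Pi.single l 1 : Fin k → ℕ) j + 1) =
        (∏ i, ∏ j ∈ Finset.univ.erase i, (z i - z j) ^ (ν j + 1)) *
          ∏ i ∈ Finset.univ.erase l, (z i - z l) := by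
      simp only [Pi.add_apply, add_right_comm _ _ 1, pow_add _ (ν _ + 1),
        Finset.prod_mul_distrib, hpow]
      congr 1
      rw [← Finset.mul_prod_erase _ _ (Finset.mem_univ l)]
      rw [if_neg (by simp), one_mul]
      refine Finset.prod_congr rfl fun i hi => ?_
      rw [if_pos (by simpa using (Finset.ne_of_mem_erase hi).symm)]
    rw [hfac, hb, hz, hsum, Nat.factorial_succ]
    push_cast at hstep hν ⊢
    linear_combination ((-1) ^ k * ((∑ j, (ν j + 1)).factorial : ℂ)) * hstep +
      ((ν l : ℂ) + 1) * (b - z l) * (∏ i ∈ Finset.univ.erase l, (z i - z l)) * hν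

end Cofactor

lemma eval_eq_add_integralTo {b c x : ℂ} {p : ℂ[X]} (h : p.eval b = c) :
    p.eval x = c + integralTo b x (derivative p) := by
  rw [integralTo_derivative, h]; ring

lemma deriv_critical_value {k : ℕ} (m : Fin k → ℕ) (hm : ∀ j, 1 ≤ m j) (d b c : ℂ)
    (q : (Fin k → ℂ) → ℂ[X])
    (hq : ∀ z : Fin k → ℂ,
      (q z).derivative = d • ∏ j, (X - C (z j)) ^ m j ∧ (q z).eval b = c)
    (z : Fin k → ℂ) (i j : Fin k) :
    deriv (fun w : ℂ => (q (Function.update z i w)).eval (Function.update z i w j)) (z i) =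
      (-d * m i) * periodMatrix b z (fun l => m l - 1) i j := by
  set R : ℂ[X] := ∏ l ∈ Finset.univ.erase i, (X - C (z l)) ^ m l with hR
  set T : ℂ[X][X] := (C X - X) ^ m i * C (d • R) with hT
  have hTe : ∀ w, T.eval (C w) = derivative (q (Function.update z i w)) := by
    intro w
    rw [(hq _).1, ← Finset.mul_prod_erase _ _ (Finset.mem_univ i)]
    have : ∏ l ∈ Finset.univ.erase i, (X - C (Function.update z i w l)) ^ m l = R :=
      Finset.prod_congr rfl fun l hl => by
        rw [Function.update_of_ne (Finset.ne_of_mem_erase hl)]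
    rw [this]
    simp [hT]
  have hfun : (fun w : ℂ => (q (Function.update z i w)).eval (Function.update z i w j)) =
      fun w => c + integralTo b (Function.update z i w j) (T.eval (C w)) := by
    funext w
    rw [hTe, ← eval_eq_add_integralTo (hq _).2]
  have hg : HasDerivAt (fun w => Function.update z i w j) (if j = i then 1 else 0) (z i) := by
    split_ifs with h
    · subst h; simpa using hasDerivAt_id' (z j)
    · simpa [Function.update_of_ne h] using hasDerivAt_const (z i) (z j)
  have hder := (hasDerivAt_integralTo_eval b T _ _ _ hg).const_add c
  have hz0 : (T.eval (C (z i))).eval (z j) = 0 := by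
    rw [hTe, (hq _).1, Function.update_eq_self, eval_smul, eval_prod,
      Finset.prod_eq_zero (Finset.mem_univ j), smul_zero]
    have := hm j
    simp [show m j ≠ 0 by omega]
  rw [hfun, hder.deriv]
  simp only [Function.update_eq_self, hz0, zero_mul, add_zero]
  have hdT : (derivative T).eval (C (z i)) = (-d * m i) •
      ((∏ l, (X - C (z l)) ^ (m l - 1)) * cofactorPoly z i) := by
    have hRP : R = (∏ l ∈ Finset.univ.erase i, (X - C (z l)) ^ (m l - 1)) * cofactorPoly z i := by
      rw [cofactorPoly, ← Finset.prod_mul_distrib, hR]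
      refine Finset.prod_congr rfl fun l _ => ?_
      rw [← pow_succ, Nat.sub_add_cancel (hm l)]
    rw [← Finset.mul_prod_erase _ _ (Finset.mem_univ i), mul_assoc, ← hRP, hT]
    simp only [derivative_mul, derivative_pow, derivative_sub, derivative_C, derivative_X,
      eval_add, eval_mul, eval_pow, eval_sub, eval_C, eval_X, smul_eq_C_mul]
    simp
    ring
  rw [hdT, map_smul, smul_eq_mul, periodMatrix, Matrix.of_apply]

/-- Jacobian factorization for the critical-points-to-critical-values map (Theorem B, in
base-pair form).  Here `q z` is the unique monic degree-`d` polynomial (`d = ∑ m j + 1`)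
with critical points `z j` of multiplicity `m j` and with `(q z).eval b = c`, `θ z j =
(q z).eval (z j)` is the critical value map, and `J z` is its Jacobian matrix.  Then
`multinomial(m) · det (J z) = d^k · ∏ⱼ (b - z j)^(m j) · ∏_{i ≠ j} (z i - z j)^(m j)`;
in particular `J z` is invertible iff the `z j` are pairwise distinct and none is `b`. -/
theorem stmt_19 (k : ℕ) (hk : 1 ≤ k) (m : Fin k → ℕ) (hm : ∀ j, 1 ≤ m j)
    (b c : ℂ) (q : (Fin k → ℂ) → ℂ[X])
    (hq : ∀ z : Fin k → ℂ,
      (q z).derivative =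
        ((((∑ j, m j) + 1 : ℕ) : ℂ) • ∏ j, (X - C (z j)) ^ (m j)) ∧
      (q z).eval b = c)
    (J : (Fin k → ℂ) → Matrix (Fin k) (Fin k) ℂ)
    (hJ : ∀ (z : Fin k → ℂ) (i j : Fin k), J z i j =
      deriv (fun w : ℂ =>
        (q (Function.update z i w)).eval (Function.update z i w j)) (z i))
    (z : Fin k → ℂ) :
    (Nat.multinomial Finset.univ m : ℂ) * (J z).det =
        ((((∑ j, m j) + 1 : ℕ) : ℂ)) ^ k * (∏ j, (b - z j) ^ (m j)) *
          (∏ i, ∏ j ∈ Finset.univ.erase i, (z i - z j) ^ (m j)) ∧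
      (IsUnit (J z).det ↔ (Function.Injective z ∧ ∀ j, z j ≠ b)) := by
  have hJm : J z = Matrix.of fun i j => (-(((∑ j, m j) + 1 : ℕ) : ℂ) * m i) *
      periodMatrix b z (fun l => m l - 1) i j := by
    ext i j
    rw [hJ, Matrix.of_apply]
    exact deriv_critical_value m hm _ b c q hq z i j
  set d : ℂ := (((∑ j, m j) + 1 : ℕ) : ℂ) with hd
  have hd0 : d ≠ 0 := Nat.cast_ne_zero.mpr (Nat.succ_ne_zero _)
  have hdet := det_periodMatrix b z (fun l => m l - 1)
  simp only [Nat.sub_add_cancel (hm _)] at hdet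
  have hfac0 : ∏ j, ((m j - 1).factorial : ℂ) ≠ 0 :=
    Finset.prod_ne_zero_iff.mpr fun j _ => Nat.cast_ne_zero.mpr (Nat.factorial_ne_zero _)
  have hmul : (∏ j, ((m j - 1).factorial : ℂ)) * (∏ j, (m j : ℂ)) *
      (Nat.multinomial Finset.univ m : ℂ) = ((∑ j, m j).factorial : ℂ) := by
    rw [← Nat.multinomial_spec Finset.univ m, ← Finset.prod_mul_distrib]
    push_cast
    congr 1
    refine Finset.prod_congr rfl fun j _ => ?_
    rw [mul_comm, ← Nat.cast_mul, Nat.mul_factorial_pred (by have := hm j; omega)]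
  have key : (Nat.multinomial Finset.univ m : ℂ) * (J z).det =
        d ^ k * (∏ j, (b - z j) ^ (m j)) *
          (∏ i, ∏ j ∈ Finset.univ.erase i, (z i - z j) ^ (m j)) := by
    refine mul_left_cancel₀ hfac0 ?_
    rw [hJm, Matrix.det_mul_column, Finset.prod_mul_distrib, Fin.prod_const, neg_pow]
    linear_combination ((-1) ^ k * d ^ k * (periodMatrix b z (fun l => m l - 1)).det) * hmul +
      d ^ k * hdet
  refine ⟨key, ?_⟩
  have hM : (Nat.multinomial Finset.univ m : ℂ) ≠ 0 :=
    Nat.cast_ne_zero.mpr (Nat.multinomial_pos _ _).ne'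
  have hm0 : ∀ j, m j ≠ 0 := fun j => Nat.one_le_iff_ne_zero.mp (hm j)
  have hiff : (J z).det ≠ 0 ↔ (Nat.multinomial Finset.univ m : ℂ) * (J z).det ≠ 0 := by
    simp [hM]
  rw [isUnit_iff_ne_zero, hiff, key]
  simp only [mul_ne_zero_iff, Finset.prod_ne_zero_iff, pow_ne_zero_iff (hm0 _), sub_ne_zero,
    Finset.mem_univ, Finset.mem_erase, true_implies, and_true]
  constructor
  · rintro ⟨⟨-, h1⟩, h2⟩
    exact ⟨fun i j hij => by_contra fun hne => h2 i j (Ne.symm hne) hij, fun j => (h1 j).symm⟩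
  · rintro ⟨h1, h2⟩
    exact ⟨⟨pow_ne_zero k hd0, fun j => (h2 j).symm⟩, fun i j hne hij => hne (h1 hij).symm⟩
end
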